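/- arXiv:1004.1520 — 5 statements merged into one kernel-verified Lean document; each statement's English description precedes it below -/
import Mathlib

section
/- Let d ∈ {2, 7, 11, 19, 43, 67, 163} (these are exactly the squarefree d ∉ {1,3} for which the imaginary quadratic field ℚ(√−d) has class number 1) and let m be a positive integer. If the shell S_d(m) = {(a,b) ∈ ℤ × ℤ : Q_d(a,b) = m} is nonempty, then ∑_{(a,b) ∈ S_d(m)} V_d(a,b) ≠ 0. In particular, the shell of norm m of the ring of integers of ℚ(√−d), viewed as a lattice in ℝ², is not a spherical 2-design. -/
/-- The norm form `Q_d` of the ring of integers of `ℚ(√−d)` on `ℤ²`: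
`a² + d·b²` if `d ≡ 1, 2 (mod 4)`, and `a² + a·b + ((1+d)/4)·b²` if `d ≡ 3 (mod 4)`. -/
def Qf (d : ℕ) (p : ℤ × ℤ) : ℤ :=
  if d % 4 = 3 then p.1 ^ 2 + p.1 * p.2 + (((1 + d) / 4 : ℕ) : ℤ) * p.2 ^ 2
  else p.1 ^ 2 + (d : ℤ) * p.2 ^ 2

/-- The value `V_d(a,b)` of the harmonic polynomial `x² − y²` at the point of `ℝ² = ℂ`
corresponding to `(a,b)` under the standard embedding of the ring of integers of `ℚ(√−d)`. -/
def Vf (d : ℕ) (p : ℤ × ℤ) : ℚ :=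
  if d % 4 = 3 then ((2 * (p.1 : ℚ) + (p.2 : ℚ)) ^ 2 - (d : ℚ) * (p.2 : ℚ) ^ 2) / 4
  else (p.1 : ℚ) ^ 2 - (d : ℚ) * (p.2 : ℚ) ^ 2

/-- The shell of norm `m`: `S_d(m) = {(a,b) ∈ ℤ × ℤ : Q_d(a,b) = m}`. -/
def shell (d m : ℕ) : Set (ℤ × ℤ) := {p | Qf d p = (m : ℤ)}

namespace QShell
open QuadraticAlgebra

abbrev OO (q t : ℤ) := QuadraticAlgebra ℤ (-q) t

variable {q t : ℤ}

theorem four_norm (z : OO q t) :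
    4 * QuadraticAlgebra.norm z = (2 * z.re + t * z.im) ^ 2 + (4 * q - t ^ 2) * z.im ^ 2 := by
  rw [QuadraticAlgebra.norm_def]; ring

theorem norm_nn (hD : 4 < 4 * q - t ^ 2) (z : OO q t) : 0 ≤ QuadraticAlgebra.norm z := by
  have h := four_norm z
  nlinarith [sq_nonneg (2 * z.re + t * z.im), sq_nonneg z.im]

theorem eq_zero_of_norm (hD : 4 < 4 * q - t ^ 2) (z : OO q t) (hz : QuadraticAlgebra.norm z = 0) : z = 0 := by
  have h := four_norm z
  rw [hz] at h
  have h1 : z.im ^ 2 = 0 := by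
    nlinarith [sq_nonneg (2 * z.re + t * z.im), sq_nonneg z.im]
  have h1' : z.im = 0 := by simpa using h1
  have h2 : (2 * z.re + t * z.im) ^ 2 = 0 := by
    nlinarith [sq_nonneg (2 * z.re + t * z.im), sq_nonneg z.im]
  have h2' : 2 * z.re + t * z.im = 0 := by simpa using h2
  rw [h1'] at h2'
  ext
  · simp; linarith
  · simpa using h1'

theorem norm_pos' (hD : 4 < 4 * q - t ^ 2) (z : OO q t) (hz : z ≠ 0) : 0 < QuadraticAlgebra.norm z :=
  lt_of_le_of_ne (norm_nn hD z) (fun h => hz (eq_zero_of_norm hD z h.symm))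

theorem isDomain (hD : 4 < 4 * q - t ^ 2) : IsDomain (OO q t) := by
  have : NoZeroDivisors (OO q t) := by
    constructor
    intro a b hab
    have h : QuadraticAlgebra.norm a * QuadraticAlgebra.norm b = 0 := by rw [← map_mul, hab, QuadraticAlgebra.norm_zero]
    rcases mul_eq_zero.1 h with h | h
    · exact Or.inl (eq_zero_of_norm hD _ h)
    · exact Or.inr (eq_zero_of_norm hD _ h)
  exact NoZeroDivisors.to_isDomain _

theorem mul_star' (z : OO q t) : z * star z = ((QuadraticAlgebra.norm z : ℤ) : OO q t) := by
  rw [← algebraMap_norm_eq_mul_star]; rfl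

theorem intCast_dvd (n : ℤ) (z : OO q t) (h1 : n ∣ z.re) (h2 : n ∣ z.im) :
    (n : OO q t) ∣ z := by
  obtain ⟨a, ha⟩ := h1
  obtain ⟨b, hb⟩ := h2
  refine ⟨⟨a, b⟩, ?_⟩
  ext <;> simp [ha, hb]

theorem dvd_of_intCast_dvd (n m : ℤ) (h : (n : OO q t) ∣ (m : OO q t)) : n ∣ m := by
  obtain ⟨w, hw⟩ := h
  have := congrArg QuadraticAlgebra.re hw
  simp at this
  exact ⟨_, this⟩

/-- Dirichlet step. -/
theorem dirichlet (hD : 4 < 4 * q - t ^ 2) (M : ℕ) (hM : 0 < M)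
    (hDM : 4 * q - t ^ 2 < 3 * ((M : ℤ) + 1) ^ 2) (α β : OO q t) (hβ : β ≠ 0) :
    ∃ s : ℕ, 0 < s ∧ s ≤ M ∧ ∃ τ : OO q t, QuadraticAlgebra.norm ((s : OO q t) * α - τ * β) < QuadraticAlgebra.norm β := by
  have := isDomain hD
  have hn := norm_pos' hD β hβ
  set n := QuadraticAlgebra.norm β with hndef
  set x := α * star β with hx
  have hnR : (0 : ℝ) < n := by exact_mod_cast hn
  obtain ⟨e, s, hs0, hsM, hes⟩ := Real.exists_int_int_abs_mul_sub_le ((x.im : ℝ) / n) hM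
  lift s to ℕ using hs0.le
  have hf : ((M : ℤ) + 1) * |s * x.im - e * n| ≤ n := by
    have h1 : |(s : ℝ) * x.im - e * n| = |((s : ℤ) : ℝ) * ((x.im : ℝ) / n) - e| * n := by
      rw [← abs_of_pos hnR, ← abs_mul, abs_of_pos hnR]
      congr 1
      push_cast
      field_simp
    have h2 : ((M : ℝ) + 1) * |(s : ℝ) * x.im - e * n| ≤ n := by
      rw [h1]
      have hM1 : (0 : ℝ) < (M : ℝ) + 1 := by positivity
      rw [le_div_iff₀ hM1] at hes
      nlinarith
    exact_mod_cast h2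
  set f := s * x.im - e * n with hfdef
  -- real part
  obtain ⟨c, hc⟩ : ∃ c : ℤ, |2 * (s * x.re - c * n) + t * f| ≤ n := by
    have h2 : 0 < 2 * n := by linarith
    refine ⟨(2 * (s * x.re) + t * f + n) / (2 * n), ?_⟩
    have a1 := Int.emod_nonneg (2 * (s * x.re) + t * f + n) h2.ne'
    have a2 := Int.emod_lt_of_pos (2 * (s * x.re) + t * f + n) h2
    have a3 := Int.mul_ediv_add_emod (2 * (s * x.re) + t * f + n) (2 * n)
    rw [abs_le]
    constructor <;> nlinarith
  refine ⟨s, by exact_mod_cast hs0, by exact_mod_cast hsM, ⟨c, e⟩, ?_⟩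
  have key : ((s : OO q t) * α - ⟨c, e⟩ * β) * star β = ⟨s * x.re - c * n, f⟩ := by
    have : ((s : OO q t) * α - ⟨c, e⟩ * β) * star β
        = (s : OO q t) * x - ⟨c, e⟩ * (n : OO q t) := by
      rw [hndef, ← mul_star', hx]; ring
    rw [this]
    ext
    · simp
    · simp [hfdef]
  have hN := congrArg QuadraticAlgebra.norm key
  rw [map_mul, QuadraticAlgebra.norm_star, ← hndef] at hN
  have h4 := four_norm (⟨s * x.re - c * n, f⟩ : OO q t)
  rw [← hN] at h4
  simp only at h4
  set A := 2 * (s * x.re - c * n) + t * f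
  have hA : A ^ 2 ≤ n ^ 2 := by
    rw [← sq_abs A]; exact pow_le_pow_left₀ (abs_nonneg _) hc 2
  have hF : ((M : ℤ) + 1) ^ 2 * f ^ 2 ≤ n ^ 2 := by
    rw [← sq_abs f, ← mul_pow]; exact pow_le_pow_left₀ (by positivity) hf 2
  have hlt : (4 * q - t ^ 2) * f ^ 2 < 3 * n ^ 2 := by
    by_cases hf0 : f = 0
    · rw [hf0]; nlinarith [mul_pos hn hn]
    · have : 0 < f ^ 2 := by positivity
      nlinarith
  by_contra hcon
  push Not at hcon
  nlinarith

theorem step (hD : 4 < 4 * q - t ^ 2) (M : ℕ) (hM : 0 < M)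
    (hDM : 4 * q - t ^ 2 < 3 * ((M : ℤ) + 1) ^ 2)
    (hin : ∀ l : ℕ, l.Prime → l ≤ M → ∀ a b : ZMod l,
      a ^ 2 + t * a * b + q * b ^ 2 = 0 → a = 0 ∧ b = 0)
    (α β : OO q t) (hβ : β ≠ 0) (hαβ : ¬ β ∣ α) :
    ∃ σ τ : OO q t, σ * α - τ * β ≠ 0 ∧ QuadraticAlgebra.norm (σ * α - τ * β) < QuadraticAlgebra.norm β := by
  have := isDomain hD
  obtain ⟨s, hs0, hsM, τ, hτ⟩ := dirichlet hD M hM hDM α β hβ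
  by_cases h0 : (s : OO q t) * α - τ * β = 0
  swap
  · exact ⟨s, τ, h0, hτ⟩
  have hex : ∃ s : ℕ, 0 < s ∧ s ≤ M ∧ β ∣ (s : OO q t) * α :=
    ⟨s, hs0, hsM, τ, by rw [sub_eq_zero.1 h0]; ring⟩
  classical
  clear h0 hτ τ hs0 hsM s
  obtain ⟨hs0, hsM, hs⟩ := Nat.find_spec hex
  have hmin := fun k => Nat.find_min hex (m := k)
  set s := Nat.find hex
  have hs1 : s ≠ 1 := by
    intro h; rw [h] at hs; simp at hs; exact hαβ hs
  have hl := Nat.minFac_prime hs1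
  set l := s.minFac
  obtain ⟨s', hs'⟩ : l ∣ s := Nat.minFac_dvd s
  have hlM : l ≤ M := (Nat.minFac_le hs0).trans hsM
  have hs'0 : 0 < s' := by
    rcases Nat.eq_zero_or_pos s' with h | h
    · rw [h] at hs'; omega
    · exact h
  have hs's : s' < s := by rw [hs']; nlinarith [hl.two_le]
  have hnd : ¬ β ∣ (s' : OO q t) * α := fun h => hmin s' hs's ⟨hs'0, by omega, h⟩
  obtain ⟨τ, hτ⟩ := hs
  set α' := (s' : OO q t) * α with hα'
  have hlα : (l : OO q t) * α' = τ * β := by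
    rw [hα', ← mul_assoc, ← Nat.cast_mul, ← hs', hτ]; ring
  have hl0 : (l : OO q t) ≠ 0 := by
    intro h
    have := congrArg QuadraticAlgebra.re h
    simp at this
    exact hl.ne_zero this
  have hτl : ¬ (l : OO q t) ∣ τ := by
    rintro ⟨w, hw⟩
    apply hnd
    refine ⟨w, mul_left_cancel₀ hl0 ?_⟩
    rw [hlα, hw]; ring
  have hNl : ¬ (l : ℤ) ∣ QuadraticAlgebra.norm τ := by
    intro h
    apply hτl
    rw [QuadraticAlgebra.norm_def] at h
    rw [← ZMod.intCast_zmod_eq_zero_iff_dvd _ l] at h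
    have := hin l hl hlM τ.re τ.im (by rw [← h]; push_cast; ring)
    rw [ZMod.intCast_zmod_eq_zero_iff_dvd, ZMod.intCast_zmod_eq_zero_iff_dvd] at this
    have := intCast_dvd (l : ℤ) τ this.1 this.2
    simpa using this
  have hlp : (0 : ℤ) < l := by exact_mod_cast hl.pos
  set r := QuadraticAlgebra.norm τ % (l : ℤ) with hr
  set e := QuadraticAlgebra.norm τ / (l : ℤ) with he
  have hr0 : 0 ≤ r := Int.emod_nonneg _ hlp.ne'
  have hr1 : r < l := Int.emod_lt_of_pos _ hlp
  have hr2 : r ≠ 0 := fun h => hNl (Int.dvd_of_emod_eq_zero h)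
  have hre : QuadraticAlgebra.norm τ = l * e + r := (Int.mul_ediv_add_emod _ _).symm
  have key : (l : OO q t) * (star τ * s' * α - e * β) = (r : OO q t) * β := by
    have h1 : (l : OO q t) * (star τ * s' * α - e * β)
        = star τ * ((l : OO q t) * α') - l * e * β := by rw [hα']; ring
    have h2 : τ * star τ = (l : OO q t) * e + r := by
      rw [mul_star', hre]; push_cast; ring
    rw [h1, hlα]
    linear_combination β * h2
  have hN := congrArg QuadraticAlgebra.norm key
  rw [map_mul, map_mul, QuadraticAlgebra.norm_natCast, QuadraticAlgebra.norm_intCast, Int.cast_id] at hN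
  have hn := norm_pos' hD β hβ
  have hrp : 0 < r := by omega
  refine ⟨star τ * s', e, ?_, ?_⟩
  · intro h
    rw [h, QuadraticAlgebra.norm_zero, mul_zero] at hN
    have : 0 < r ^ 2 * QuadraticAlgebra.norm β := by positivity
    omega
  · by_contra hcon
    push Not at hcon
    have : r ^ 2 < (l : ℤ) ^ 2 := by nlinarith
    nlinarith

theorem isPID (hD : 4 < 4 * q - t ^ 2) (M : ℕ) (hM : 0 < M)
    (hDM : 4 * q - t ^ 2 < 3 * ((M : ℤ) + 1) ^ 2)
    (hin : ∀ l : ℕ, l.Prime → l ≤ M → ∀ a b : ZMod l,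
      a ^ 2 + t * a * b + q * b ^ 2 = 0 → a = 0 ∧ b = 0) :
    IsPrincipalIdealRing (OO q t) := by
  constructor
  intro I
  by_cases hI : I = ⊥
  · subst hI; exact bot_isPrincipal
  obtain ⟨b0, hb0, hb00⟩ := Submodule.exists_mem_ne_zero_of_ne_bot hI
  have hex : ∃ n : ℕ, ∃ b ∈ I, b ≠ 0 ∧ QuadraticAlgebra.norm b = n :=
    ⟨(QuadraticAlgebra.norm b0).toNat, b0, hb0, hb00, (Int.toNat_of_nonneg (norm_nn hD b0)).symm⟩
  classical
  obtain ⟨β, hβI, hβ0, hβn⟩ := Nat.find_spec hex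
  have hmin := fun k => Nat.find_min hex (m := k)
  refine ⟨β, le_antisymm ?_ ?_⟩
  · intro α hα
    rw [Ideal.submodule_span_eq, Ideal.mem_span_singleton]
    by_contra hcon
    obtain ⟨σ, τ, h1, h2⟩ := step hD M hM hDM hin α β hβ0 hcon
    have h3 := norm_nn hD (σ * α - τ * β)
    refine hmin (QuadraticAlgebra.norm (σ * α - τ * β)).toNat ?_ ⟨_, ?_, h1, (Int.toNat_of_nonneg h3).symm⟩
    · omega
    · exact I.sub_mem (I.mul_mem_left _ hα) (I.mul_mem_left _ hβI)
  · rw [Ideal.submodule_span_eq, Ideal.span_le]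
    simpa using hβI

/-- the shell -/
def Sh (q t m : ℤ) : Set (OO q t) := {z | QuadraticAlgebra.norm z = m}

theorem mem_Sh {m : ℤ} {z : OO q t} : z ∈ Sh q t m ↔ QuadraticAlgebra.norm z = m := Iff.rfl

theorem Sh_finite (hD : 4 < 4 * q - t ^ 2) (m : ℤ) : (Sh q t m).Finite := by
  have hinj : Function.Injective (fun z : OO q t => (2 * z.re + t * z.im, z.im)) := by
    intro z w h
    simp only [Prod.mk.injEq] at h
    obtain ⟨h1, h2⟩ := h
    rw [h2] at h1
    ext
    · linarith
    · exact h2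
  refine Set.Finite.subset (Set.Finite.preimage hinj.injOn
    ((Set.finite_Icc (-(4 * m)) (4 * m)).prod (Set.finite_Icc (-(4 * m)) (4 * m)))) ?_
  intro z hz
  rw [mem_Sh] at hz
  have h := four_norm z
  rw [hz] at h
  have b : ∀ x : ℤ, x ^ 2 ≤ 4 * m → x ∈ Set.Icc (-(4 * m)) (4 * m) := by
    intro x hx
    constructor <;> nlinarith [Int.le_self_sq x, Int.le_self_sq (-x)]
  refine ⟨b _ ?_, b _ ?_⟩
  · simp only; nlinarith [sq_nonneg (2 * z.re + t * z.im), sq_nonneg z.im]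
  · simp only; nlinarith [sq_nonneg (2 * z.re + t * z.im), sq_nonneg z.im]

noncomputable def cc (q t m : ℤ) : OO q t := ∑ᶠ z ∈ Sh q t m, z ^ 2

theorem sum_image (hD : 4 < 4 * q - t ^ 2) (g : OO q t) (hg : g ≠ 0) (m : ℤ) :
    ∑ᶠ z ∈ (fun w => g * w) '' Sh q t m, z ^ 2 = g ^ 2 * cc q t m := by
  have := isDomain hD
  rw [finsum_mem_image (fun a _ b _ h => mul_left_cancel₀ hg h), cc,
    mul_finsum_mem]
  simp only [mul_pow]

theorem cc_one (hD : 4 < 4 * q - t ^ 2) : cc q t 1 ≠ 0 := by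
  have h1 : ∀ z ∈ Sh q t 1, z ^ 2 = 1 := by
    intro z hz
    rw [mem_Sh] at hz
    have h := four_norm z
    rw [hz] at h
    have h1 : z.im ^ 2 < 1 := by
      nlinarith [sq_nonneg (2 * z.re + t * z.im), sq_nonneg z.im]
    have h2 : z.im = 0 := by
      have : z.im ^ 2 = 0 := by nlinarith [sq_nonneg z.im]
      simpa using this
    rw [h2] at h
    have h3 : z.re * z.re = 1 := by nlinarith
    ext <;> simp [sq, h2, h3]
  rw [cc, finsum_mem_congr rfl h1]
  have hf := Sh_finite hD 1
  rw [finsum_mem_eq_finite_toFinset_sum _ hf]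
  intro h
  simp only [Finset.sum_const, nsmul_eq_mul, mul_one] at h
  have h' := congrArg QuadraticAlgebra.re h
  simp at h'
  have : (1 : OO q t) ∈ Sh q t 1 := by rw [mem_Sh]; simp
  rw [h'] at this
  exact this

theorem cc_ne_zero (hD : 4 < 4 * q - t ^ 2) (hP : IsPrincipalIdealRing (OO q t)) (k : ℕ) :
    ∀ m : ℤ, m = k → 0 < m → (Sh q t m).Nonempty → cc q t m ≠ 0 := by
  have := isDomain hD
  induction k using Nat.strong_induction_on with
  | _ k ih =>
  rintro m hmk hm ⟨z, hz⟩
  rw [mem_Sh] at hz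
  rcases eq_or_lt_of_le (show (1 : ℤ) ≤ m from hm) with h1 | h1
  · rw [← h1]; exact cc_one hD
  have ih' : ∀ m' : ℤ, 0 < m' → m' < m → (Sh q t m').Nonempty → cc q t m' ≠ 0 := by
    intro m' h0 h2 h3
    refine ih m'.toNat (by omega) m' (by omega) h0 h3
  have hz0 : z ≠ 0 := by rintro rfl; rw [QuadraticAlgebra.norm_zero] at hz; omega
  have hzu : ¬ IsUnit z := by
    rw [isUnit_iff_norm_isUnit, hz, Int.isUnit_iff]; omega
  obtain ⟨π, hπi, w, hw⟩ := WfDvdMonoid.exists_irreducible_factor hzu hz0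
  have hπ : Prime π := hπi.prime
  have hπ0 := hπ.ne_zero
  have hp0 := norm_pos' hD π hπ0
  have hp1 : QuadraticAlgebra.norm π ≠ 1 := by
    intro h
    exact hπ.not_isUnit (isUnit_iff_norm_isUnit.2 (by rw [h]; exact isUnit_one))
  have hp : 1 < QuadraticAlgebra.norm π := by omega
  have hpm : m = QuadraticAlgebra.norm π * QuadraticAlgebra.norm w := by rw [← hz, hw, map_mul]
  have hw0 : 0 < QuadraticAlgebra.norm w := by
    by_contra h
    push Not at h
    nlinarith
  have hwm : QuadraticAlgebra.norm w < m := by nlinarith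
  have hπp : π ∣ ((QuadraticAlgebra.norm π : ℤ) : OO q t) := ⟨star π, (mul_star' π).symm⟩
  by_cases hs : π ∣ star π
  · have hS : Sh q t m = (fun w => π * w) '' Sh q t (QuadraticAlgebra.norm w) := by
      ext y
      simp only [Set.mem_image, mem_Sh]
      constructor
      · intro hy
        have h2 : π ∣ y * star y := by
          rw [mul_star', hy, hpm]; push_cast
          exact hπp.mul_right _
        have h3 : π ∣ y := by
          rcases hπ.dvd_or_dvd h2 with h | ⟨v, hv⟩
          · exact h
          · refine hs.trans ⟨star v, ?_⟩
            rw [← star_star y, hv, star_mul, mul_comm]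
        obtain ⟨v, rfl⟩ := h3
        refine ⟨v, ?_, rfl⟩
        rw [map_mul, hpm] at hy
        exact mul_left_cancel₀ hp0.ne' hy
      · rintro ⟨v, hv, rfl⟩
        rw [map_mul, hv, hpm]
    rw [cc, hS, sum_image hD π hπ0]
    exact mul_ne_zero (pow_ne_zero _ hπ0) (ih' _ hw0 hwm ⟨w, rfl⟩)
  -- split case
  set p := QuadraticAlgebra.norm π with hpdef
  obtain ⟨j, n, hpn, hmn⟩ : ∃ (j : ℕ) (n : ℤ), ¬ p ∣ n ∧ m = p ^ j * n := by
    have hfin : FiniteMultiplicity p m :=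
      Int.finiteMultiplicity_iff.2 ⟨by omega, by omega⟩
    obtain ⟨n, h1, h2⟩ := hfin.exists_eq_pow_mul_and_not_dvd
    exact ⟨_, n, h2, h1⟩
  have hj : j ≠ 0 := by
    rintro rfl
    apply hpn
    rw [pow_zero, one_mul] at hmn
    exact ⟨_, hmn ▸ hpm⟩
  have hn0 : 0 < n := by
    have : 0 < p ^ j := by positivity
    by_contra h
    push Not at h
    nlinarith
  have hnm : n < m := by
    have : 1 < p ^ j := one_lt_pow₀ hp hj
    nlinarith
  have hsπ0 : star π ≠ 0 := by simpa using hπ0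
  have hπn : ¬ π ∣ (n : OO q t) := by
    rintro ⟨v, hv⟩
    have h2 : π ∣ star π * star v := by
      refine ⟨v, ?_⟩
      have h3 := congrArg star hv
      rw [star_mul, star_intCast, hv] at h3
      rw [h3, mul_comm]
    rcases hπ.dvd_or_dvd h2 with h | ⟨u, hu⟩
    · exact hs h
    · apply hpn
      apply dvd_of_intCast_dvd (q := q) (t := t)
      refine ⟨star u, ?_⟩
      rw [hpdef, ← mul_star', hv, ← star_star v, hu, star_mul]; ring
  -- elements not divisible by π
  have hA : ∀ i : ℕ, ∀ y : OO q t, QuadraticAlgebra.norm y = p ^ i * n → ¬ π ∣ y →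
      ∃ v, QuadraticAlgebra.norm v = n ∧ y = star π ^ i * v := by
    intro i
    induction i with
    | zero => intro y hy _; exact ⟨y, by simpa using hy, by simp⟩
    | succ i ihi =>
      intro y hy hyd
      have h2 : π ∣ y * star y := by
        rw [mul_star', hy, pow_succ', mul_assoc]; push_cast
        exact hπp.mul_right _
      obtain ⟨v, hv⟩ := (hπ.dvd_or_dvd h2).resolve_left hyd
      have hy' : y = star π * star v := by
        rw [← star_star y, hv, star_mul, mul_comm]
      have hnv : QuadraticAlgebra.norm (star v) = p ^ i * n := by
        rw [hy', map_mul, QuadraticAlgebra.norm_star, ← hpdef, pow_succ', mul_assoc] at hy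
        exact mul_left_cancel₀ hp0.ne' hy
      obtain ⟨u, hu, hu2⟩ := ihi _ hnv (fun h => hyd (by rw [hy']; exact h.mul_left _))
      exact ⟨u, hu, by rw [hy', hu2, pow_succ']; ring⟩
  have hne : (Sh q t n).Nonempty := by
    have : ∀ i : ℕ, ∀ y : OO q t, QuadraticAlgebra.norm y = p ^ i * n → (Sh q t n).Nonempty := by
      intro i
      induction i with
      | zero => intro y hy; exact ⟨y, by simpa [mem_Sh] using hy⟩
      | succ i ihi =>
        intro y hy
        by_cases hd : π ∣ y
        · obtain ⟨v, rfl⟩ := hd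
          apply ihi v
          rw [map_mul, pow_succ', mul_assoc] at hy
          exact mul_left_cancel₀ hp0.ne' hy
        · obtain ⟨v, hv, _⟩ := hA _ y hy hd
          exact ⟨v, hv⟩
    exact this j z (by rw [hz, hmn])
  have hcn := ih' n hn0 hnm hne
  have hrec : ∀ i : ℕ, cc q t (p ^ (i + 1) * n) =
      (star π ^ (i + 1)) ^ 2 * cc q t n + π ^ 2 * cc q t (p ^ i * n) := by
    intro i
    have hS : Sh q t (p ^ (i + 1) * n) =
        ((fun w => star π ^ (i + 1) * w) '' Sh q t n) ∪
          ((fun w => π * w) '' Sh q t (p ^ i * n)) := by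
      ext y
      simp only [Set.mem_union, Set.mem_image, mem_Sh]
      constructor
      · intro hy
        by_cases hd : π ∣ y
        · right
          obtain ⟨v, rfl⟩ := hd
          refine ⟨v, ?_, rfl⟩
          rw [map_mul, pow_succ', mul_assoc] at hy
          exact mul_left_cancel₀ hp0.ne' hy
        · left
          obtain ⟨v, hv, h⟩ := hA _ y hy hd
          exact ⟨v, hv, h.symm⟩
      · rintro (⟨v, hv, rfl⟩ | ⟨v, hv, rfl⟩)
        · rw [map_mul, map_pow, QuadraticAlgebra.norm_star, hv]
        · rw [map_mul, hv, pow_succ', mul_assoc]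
    rw [cc, hS, finsum_mem_union, sum_image hD _ (pow_ne_zero _ hsπ0), sum_image hD _ hπ0]
    · rw [Set.disjoint_left]
      rintro _ ⟨v, hv, rfl⟩ ⟨u, hu, huv⟩
      rw [mem_Sh] at hv
      have h2 : π ∣ star π ^ (i + 1) * v := ⟨u, huv.symm⟩
      rcases hπ.dvd_or_dvd h2 with h | h
      · exact hs (hπ.dvd_of_dvd_pow h)
      · apply hπn
        rw [← hv, ← mul_star']
        exact h.mul_right _
    · exact (Sh_finite hD _).image _
    · exact (Sh_finite hD _).image _
  have hfac : ∀ i : ℕ, ∃ s : OO q t, cc q t (p ^ i * n) = s * cc q t n ∧ ¬ π ∣ s := by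
    intro i
    induction i with
    | zero => exact ⟨1, by simp, fun h => hπ.not_isUnit (isUnit_of_dvd_one h)⟩
    | succ i ihi =>
      obtain ⟨s, hs1, hs2⟩ := ihi
      refine ⟨(star π ^ (i + 1)) ^ 2 + π ^ 2 * s, by rw [hrec, hs1]; ring, ?_⟩
      intro h
      rw [sq π, mul_assoc, dvd_add_left (dvd_mul_right _ _)] at h
      exact hs (hπ.dvd_of_dvd_pow (hπ.dvd_of_dvd_pow h))
  obtain ⟨s, hs1, hs2⟩ := hfac j
  rw [hmn, hs1]
  refine mul_ne_zero ?_ hcn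
  rintro rfl
  exact hs2 (dvd_zero _)

/-- `2 Σ z² = Σ trace (z²)`. -/
theorem trace_sum_ne (hD : 4 < 4 * q - t ^ 2) (hP : IsPrincipalIdealRing (OO q t)) (m : ℤ)
    (hm : 0 < m) (hne : (Sh q t m).Nonempty) :
    ∑ᶠ z ∈ Sh q t m, trace (z ^ 2) ≠ 0 := by
  have := isDomain hD
  have h := cc_ne_zero hD hP m.toNat m (by omega) hm hne
  have hf := Sh_finite hD m
  have hstar : star (cc q t m) = cc q t m := by
    have hS : Sh q t m = star '' Sh q t m := by
      ext y
      simp only [Set.mem_image, mem_Sh]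
      constructor
      · intro hy; exact ⟨star y, by rw [QuadraticAlgebra.norm_star, hy], star_star y⟩
      · rintro ⟨v, hv, rfl⟩; rw [QuadraticAlgebra.norm_star, hv]
    conv_rhs => rw [cc, hS, finsum_mem_image (star_injective.injOn)]
    rw [cc, finsum_mem_eq_finite_toFinset_sum _ hf, finsum_mem_eq_finite_toFinset_sum _ hf,
      star_sum]
    simp only [star_pow]
  intro h0
  apply h
  have h1 : trace (cc q t m) = 0 := by
    rw [← h0, cc, finsum_mem_eq_finite_toFinset_sum _ hf, finsum_mem_eq_finite_toFinset_sum _ hf,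
      map_sum]
  have h2 := algebraMap_trace_eq_add_star (cc q t m)
  rw [h1, hstar, map_zero] at h2
  have h3 := congrArg QuadraticAlgebra.re h2
  have h4 := congrArg QuadraticAlgebra.im h2
  simp at h3 h4
  ext
  · simp; omega
  · simp; omega


theorem final (hD : 4 < 4 * q - t ^ 2) (M : ℕ) (hM : 0 < M)
    (hDM : 4 * q - t ^ 2 < 3 * ((M : ℤ) + 1) ^ 2)
    (hin : ∀ l : ℕ, l.Prime → l ≤ M → ∀ a b : ZMod l,
      a ^ 2 + t * a * b + q * b ^ 2 = 0 → a = 0 ∧ b = 0)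
    (d m : ℕ) (hQ : ∀ p : ℤ × ℤ, Qf d p = p.1 ^ 2 + t * p.1 * p.2 + q * p.2 ^ 2)
    (hV : ∀ p : ℤ × ℤ, 2 * Vf d p =
      ((2 * (p.1 ^ 2 - q * p.2 ^ 2) + t * (2 * p.1 * p.2 + t * p.2 ^ 2) : ℤ) : ℚ))
    (hm : 0 < m) (hne : (shell d m).Nonempty) :
    (∑ᶠ p ∈ shell d m, Vf d p) ≠ 0 := by
  have hP := isPID hD M hM hDM hin
  have hS : shell d m = (fun z : OO q t => (z.re, z.im)) '' Sh q t m := by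
    ext ⟨a, b⟩
    simp only [shell, Set.mem_ofPred_eq, hQ, Set.mem_image, mem_Sh, QuadraticAlgebra.norm_def]
    constructor
    · intro h
      exact ⟨⟨a, b⟩, by rw [← h]; ring, rfl⟩
    · rintro ⟨z, hz, h⟩
      rw [Prod.mk.injEq] at h
      rw [← hz, h.1, h.2]; ring
  have hne' : (Sh q t m).Nonempty := by
    rw [hS] at hne; exact hne.of_image
  have hmain := trace_sum_ne hD hP m (by exact_mod_cast hm) hne'
  have hf := Sh_finite hD (m : ℤ)
  have hinj : Function.Injective (fun z : OO q t => (z.re, z.im)) := by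
    intro z w h
    rw [Prod.mk.injEq] at h
    exact QuadraticAlgebra.ext h.1 h.2
  intro h0
  apply hmain
  rw [hS, finsum_mem_image hinj.injOn, finsum_mem_eq_finite_toFinset_sum _ hf] at h0
  rw [finsum_mem_eq_finite_toFinset_sum _ hf]
  have h1 : ((∑ z ∈ hf.toFinset, trace (z ^ 2) : ℤ) : ℚ) = 0 := by
    rw [← mul_zero (2 : ℚ), ← h0, Finset.mul_sum, Int.cast_sum]
    refine Finset.sum_congr rfl (fun z _ => ?_)
    rw [hV, trace_def, sq]
    simp only [re_mul, im_mul]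
    congr 1
    ring
  exact_mod_cast h1

end QShell

/-- For `d ∈ {2, 7, 11, 19, 43, 67, 163}` (the squarefree `d ∉ {1,3}` of class number 1)
and any positive integer `m`, if the shell `S_d(m)` is nonempty then
`∑_{(a,b) ∈ S_d(m)} V_d(a,b) ≠ 0`; in particular the shell of norm `m` of the ring of
integers of `ℚ(√−d)` is not a spherical 2-design. -/
theorem stmt_0 (d : ℕ) (hd : d ∈ ({2, 7, 11, 19, 43, 67, 163} : Finset ℕ))
    (m : ℕ) (hm : 0 < m) (hne : (shell d m).Nonempty) :
    (∑ᶠ p ∈ shell d m, Vf d p) ≠ 0 := by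
  simp only [Finset.mem_insert, Finset.mem_singleton] at hd
  rcases hd with rfl | rfl | rfl | rfl | rfl | rfl | rfl
  · refine QShell.final (q := 2) (t := 0) (by norm_num) 1 (by norm_num) (by norm_num) ?_ _ _
      (fun p => by simp [Qf]) (fun p => by simp [Vf]) hm hne
    intro l hl hlM
    interval_cases l <;> first | (exfalso; revert hl; norm_num; done) | decide
  · refine QShell.final (q := 2) (t := 1) (by norm_num) 1 (by norm_num) (by norm_num) ?_ _ _
      (fun p => by simp [Qf]) (fun p => by simp [Vf]; ring) hm hne
    intro l hl hlM
    interval_cases l <;> first | (exfalso; revert hl; norm_num; done) | decide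
  · refine QShell.final (q := 3) (t := 1) (by norm_num) 1 (by norm_num) (by norm_num) ?_ _ _
      (fun p => by simp [Qf]) (fun p => by simp [Vf]; ring) hm hne
    intro l hl hlM
    interval_cases l <;> first | (exfalso; revert hl; norm_num; done) | decide
  · refine QShell.final (q := 5) (t := 1) (by norm_num) 2 (by norm_num) (by norm_num) ?_ _ _
      (fun p => by simp [Qf]) (fun p => by simp [Vf]; ring) hm hne
    intro l hl hlM
    interval_cases l <;> first | (exfalso; revert hl; norm_num; done) | decide
  · refine QShell.final (q := 11) (t := 1) (by norm_num) 3 (by norm_num) (by norm_num) ?_ _ _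
      (fun p => by simp [Qf]) (fun p => by simp [Vf]; ring) hm hne
    intro l hl hlM
    interval_cases l <;> first | (exfalso; revert hl; norm_num; done) | decide
  · refine QShell.final (q := 17) (t := 1) (by norm_num) 4 (by norm_num) (by norm_num) ?_ _ _
      (fun p => by simp [Qf]) (fun p => by simp [Vf]; ring) hm hne
    intro l hl hlM
    interval_cases l <;> first | (exfalso; revert hl; norm_num; done) | decide
  · refine QShell.final (q := 41) (t := 1) (by norm_num) 7 (by norm_num) (by norm_num) ?_ _ _
      (fun p => by simp [Qf]) (fun p => by simp [Vf]; ring) hm hne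
    intro l hl hlM
    interval_cases l <;> first | (exfalso; revert hl; norm_num; done) | decide
end

section
/- Let d ∈ {5, 6, 10, 13, 15, 22, 35, 37, 51, 58, 91, 115, 123, 187, 235, 267, 403, 427} (these are exactly the squarefree d for which ℚ(√−d) has class number 2) and let m be a positive integer. If the shell S_d(m) = {(a,b) ∈ ℤ × ℤ : Q_d(a,b) = m} is nonempty, then ∑_{(a,b) ∈ S_d(m)} V_d(a,b) ≠ 0. In particular, the shell of norm m of the lattice L_o attached to the principal ideal class of ℚ(√−d), i.e. its ring of integers viewed as a lattice in ℝ², is not a spherical 2-design. -/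
open ComplexConjugate in
structure Sys (L : ZMod 2 → AddSubgroup ℂ) : Prop where
  mul : ∀ e f x y, x ∈ L e → y ∈ L f → x * y ∈ L (e + f)
  cj : ∀ e x, x ∈ L e → conj x ∈ L e
  nrm : ∀ e x, x ∈ L e → ∃ n : ℕ, x * conj x = n
  fin : ∀ e (m : ℕ), {z | z ∈ L e ∧ z * conj z = m}.Finite
  unit : ∀ e z, z ∈ L e → z * conj z = 1 → z ^ 2 = 1
  key : ∀ p : ℕ, p.Prime →
    (∀ e z, z ∈ L e → ∀ m : ℕ, z * conj z = p * m → z / p ∈ L e) ∨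
    ∃ e' π, π ∈ L e' ∧ π * conj π = p ∧ ∀ e z, z ∈ L e → ∀ m : ℕ, z * conj z = p * m →
      z / π ∈ L (e + e') ∨ z / conj π ∈ L (e + e')
  tr : ∀ e z (p : ℕ), p.Prime → z ∈ L e → z * conj z = p →
    ∃ t : ℤ, z ^ 2 + (conj z) ^ 2 = t ∧ ((p : ℤ) ∣ t → conj z = z ∨ conj z = - z)

section
open ComplexConjugate

def TT (L : ZMod 2 → AddSubgroup ℂ) (e : ZMod 2) (m : ℕ) : Set ℂ :=
  {z | z ∈ L e ∧ z * conj z = m}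

noncomputable def GG (L : ZMod 2 → AddSubgroup ℂ) (e : ZMod 2) (m : ℕ) : ℂ :=
  ∑ᶠ z ∈ TT L e m, z ^ 2

variable {L : ZMod 2 → AddSubgroup ℂ}

lemma Sys.finT (S : Sys L) (e : ZMod 2) (m : ℕ) : (TT L e m).Finite := S.fin e m

lemma Sys.smul_image (S : Sys L) (e : ZMod 2) (m : ℕ) (w : ℂ) (hw : w ≠ 0) :
    ∑ᶠ z ∈ (fun z => w * z) '' TT L e m, z ^ 2 = w ^ 2 * GG L e m := by
  rw [finsum_mem_image (fun a _ b _ h => mul_left_cancel₀ hw h)]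
  unfold GG
  rw [← smul_eq_mul, smul_finsum_mem (S.finT e m)]
  · refine finsum_mem_congr rfl fun z _ => ?_
    simp [mul_pow]

lemma zz (e f : ZMod 2) : e + f + f = e := by revert e f; decide

lemma Sys.bez (z : ℂ) (e : ZMod 2) (p : ℕ) (hp : p.Prime) (t : ℤ) (ht : ¬ (p : ℤ) ∣ t)
    (h1 : (t : ℂ) * z ∈ L e) (h2 : (p : ℂ) * z ∈ L e) : z ∈ L e := by
  have hc : IsCoprime (p : ℤ) t := (Nat.prime_iff_prime_int.mp hp).coprime_iff_not_dvd.mpr ht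
  obtain ⟨a, b, hab⟩ := hc
  have : z = a • ((p : ℂ) * z) + b • ((t : ℂ) * z) := by
    simp only [zsmul_eq_mul]
    have : (a : ℂ) * p + b * t = 1 := by exact_mod_cast hab
    linear_combination (-z) * this
  rw [this]
  exact (L e).add_mem ((L e).zsmul_mem h2 a) ((L e).zsmul_mem h1 b)

lemma Sys.mem_mul (S : Sys L) {e e' : ZMod 2} {m p : ℕ} {π z : ℂ} (hπ : π ∈ L e')
    (hn : π * conj π = p) (hz : z ∈ TT L (e + e') m) : π * z ∈ TT L e (p * m) := by
  refine ⟨?_, ?_⟩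
  · have := S.mul _ _ _ _ hz.1 hπ
    rw [zz] at this
    rwa [mul_comm]
  · have := hz.2
    push_cast
    rw [map_mul, ← this, ← hn]; ring

lemma mem_div {e e' : ZMod 2} {m p : ℕ} (hp : p ≠ 0) {π z : ℂ} 
    (hn : π * conj π = p) (hz : z ∈ TT L e (p * m)) (h : z / π ∈ L (e + e')) :
    z / π ∈ TT L (e + e') m := by
  refine ⟨h, ?_⟩
  have := hz.2
  have hp' : (p : ℂ) ≠ 0 := by exact_mod_cast hp
  have h0 : π * conj π ≠ 0 := by rw [hn]; exact hp'
  rw [map_div₀, div_mul_div_comm, this, hn]; push_cast; field_simp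

/-- Ramified prime. -/
lemma Sys.ram (S : Sys L) {e e' : ZMod 2} {m p : ℕ} (hp : p.Prime) {π : ℂ} (hπ : π ∈ L e')
    (hn : π * conj π = p) 
    (hk : ∀ e z, z ∈ L e → ∀ m : ℕ, z * conj z = p * m →
      z / π ∈ L (e + e') ∨ z / conj π ∈ L (e + e')) (hr : conj π = π ∨ conj π = - π) :
    TT L e (p * m) = (fun z => π * z) '' TT L (e + e') m := by
  have hp' : (p : ℂ) ≠ 0 := by exact_mod_cast hp.ne_zero
  have h0 : π ≠ 0 := by rintro rfl; simp at hn; exact hp' hn.symm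
  ext z; constructor
  · intro hz
    have : z / π ∈ L (e + e') := by
      have h2 := hz.2
      push_cast at h2
      rcases hk e z hz.1 m h2 with h | h
      · exact h
      · rcases hr with hr | hr <;> rw [hr] at h
        · exact h
        · rw [div_neg] at h; simpa using h
    exact ⟨z / π, mem_div hp.ne_zero hn hz this, by field_simp⟩
  · rintro ⟨w, hw, rfl⟩
    exact S.mem_mul hπ hn hw

lemma Sys.splitU (S : Sys L) {e e' : ZMod 2} {m p : ℕ} (hp : p.Prime) {π : ℂ} (hπ : π ∈ L e')
    (hn : π * conj π = p) 
    (hk : ∀ e z, z ∈ L e → ∀ m : ℕ, z * conj z = p * m →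
      z / π ∈ L (e + e') ∨ z / conj π ∈ L (e + e')) :
    TT L e (p * m) = (fun z => π * z) '' TT L (e + e') m ∪ 
      (fun z => conj π * z) '' TT L (e + e') m := by
  have hp' : (p : ℂ) ≠ 0 := by exact_mod_cast hp.ne_zero
  have h0 : π ≠ 0 := by rintro rfl; simp at hn; exact hp' hn.symm
  have h0' : conj π ≠ 0 := by simpa using h0
  have hn' : conj π * conj (conj π) = p := by rw [Complex.conj_conj, mul_comm, hn]
  ext z; constructor
  · intro hz
    have h2 := hz.2
    push_cast at h2
    rcases hk e z hz.1 m h2 with h | h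
    · left; exact ⟨z / π, mem_div hp.ne_zero hn hz h, by field_simp⟩
    · right; exact ⟨z / conj π, mem_div hp.ne_zero hn' hz h, by field_simp⟩
  · rintro (⟨w, hw, rfl⟩ | ⟨w, hw, rfl⟩)
    · exact S.mem_mul hπ hn hw
    · exact S.mem_mul (S.cj _ _ hπ) hn' hw

lemma Sys.splitI (S : Sys L) {e e' : ZMod 2} {m p : ℕ} (hp : p.Prime) {π : ℂ} (hπ : π ∈ L e')
    (hn : π * conj π = p) {t : ℤ} (ht : π ^ 2 + (conj π) ^ 2 = t) (hpt : ¬ (p : ℤ) ∣ t) {z : ℂ}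
    (h1 : z ∈ (fun z => π * z) '' TT L (e + e') m)
    (h2 : z ∈ (fun z => conj π * z) '' TT L (e + e') m) : z / p ∈ L e := by
  have hp' : (p : ℂ) ≠ 0 := by exact_mod_cast hp.ne_zero
  have h0 : π ≠ 0 := by rintro rfl; simp at hn; exact hp' hn.symm
  have h0' : conj π ≠ 0 := by simpa using h0
  obtain ⟨w, hw, rfl⟩ := h1
  obtain ⟨w', hw', hww⟩ := h2
  simp only at hww ⊢
  refine Sys.bez _ e p hp t hpt ?_ ?_
  · have e1 : (t : ℂ) * (π * w / p) = w' * π + w * conj π := by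
      rw [← ht, ← hn]; field_simp
      linear_combination (-π) * hww
    rw [e1]
    refine (L e).add_mem ?_ ?_
    · have := S.mul _ _ _ _ hw'.1 hπ
      rwa [zz] at this
    · have := S.mul _ _ _ _ hw.1 (S.cj _ _ hπ)
      rwa [zz] at this
  · have e1 : (p : ℂ) * (π * w / p) = w * π := by field_simp
    rw [e1]
    have := S.mul _ _ _ _ hw.1 hπ
    rwa [zz] at this


/-- Hecke relation, no division. -/
lemma Sys.hecke (S : Sys L) {e e' : ZMod 2} {m p : ℕ} (hp : p.Prime) {π : ℂ} (hπ : π ∈ L e')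
    (hn : π * conj π = p) 
    (hk : ∀ e z, z ∈ L e → ∀ m : ℕ, z * conj z = p * m →
      z / π ∈ L (e + e') ∨ z / conj π ∈ L (e + e'))
    {t : ℤ} (ht : π ^ 2 + (conj π) ^ 2 = t) :
    GG L e (p * m) + ∑ᶠ z ∈ ((fun z => π * z) '' TT L (e + e') m ∩
      (fun z => conj π * z) '' TT L (e + e') m), z ^ 2 = t * GG L (e + e') m := by
  have hp' : (p : ℂ) ≠ 0 := by exact_mod_cast hp.ne_zero
  have h0 : π ≠ 0 := by rintro rfl; simp at hn; exact hp' hn.symm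
  have h0' : conj π ≠ 0 := by simpa using h0
  have := finsum_mem_union_inter (f := fun z : ℂ => z ^ 2) 
    ((S.finT (e + e') m).image (fun z => π * z))
    ((S.finT (e + e') m).image (fun z => conj π * z))
  rw [← S.splitU hp hπ hn hk, S.smul_image _ _ _ h0, S.smul_image _ _ _ h0'] at this
  rw [← ht]
  unfold GG at *
  rw [this]; ring

lemma Sys.hecke1 (S : Sys L) {e e' : ZMod 2} {m p : ℕ} (hp : p.Prime) {π : ℂ} (hπ : π ∈ L e')
    (hn : π * conj π = p) 
    (hk : ∀ e z, z ∈ L e → ∀ m : ℕ, z * conj z = p * m →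
      z / π ∈ L (e + e') ∨ z / conj π ∈ L (e + e'))
    {t : ℤ} (ht : π ^ 2 + (conj π) ^ 2 = t) (hpt : ¬ (p : ℤ) ∣ t) (hm : ¬ p ∣ m) :
    GG L e (p * m) = t * GG L (e + e') m := by
  have hp' : (p : ℂ) ≠ 0 := by exact_mod_cast hp.ne_zero
  rw [← S.hecke hp hπ hn hk ht, left_eq_add]
  convert finsum_mem_empty
  rw [Set.eq_empty_iff_forall_notMem]
  rintro z ⟨h1, h2⟩
  have h3 := S.splitI hp hπ hn ht hpt h1 h2
  obtain ⟨n, hn1⟩ := S.nrm _ _ h3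
  have h4 : z ∈ TT L e (p * m) := by
    rw [S.splitU hp hπ hn hk]; exact Or.inl h1
  have h5 := h4.2
  apply hm
  use n
  rw [map_div₀, div_mul_div_comm, h5, map_natCast] at hn1
  push_cast at hn1
  field_simp at hn1
  exact_mod_cast hn1

lemma Sys.hecke2 (S : Sys L) {e e' : ZMod 2} {m p : ℕ} (hp : p.Prime) {π : ℂ} (hπ : π ∈ L e')
    (hn : π * conj π = p) 
    (hk : ∀ e z, z ∈ L e → ∀ m : ℕ, z * conj z = p * m →
      z / π ∈ L (e + e') ∨ z / conj π ∈ L (e + e'))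
    {t : ℤ} (ht : π ^ 2 + (conj π) ^ 2 = t) (hpt : ¬ (p : ℤ) ∣ t) :
    GG L e (p * (p * m)) = t * GG L (e + e') (p * m) - p ^ 2 * GG L e m := by
  have hp' : (p : ℂ) ≠ 0 := by exact_mod_cast hp.ne_zero
  rw [← S.hecke hp hπ hn hk ht, ← S.smul_image _ _ _ hp', eq_sub_iff_add_eq, add_right_inj]
  refine finsum_mem_congr ?_ fun _ _ => rfl
  ext z
  have hn' : conj π * conj (conj π) = p := by rw [Complex.conj_conj, mul_comm, hn]
  constructor
  · rintro ⟨w, hw, rfl⟩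
    have hw' : w ∈ TT L (e + e' + e') m := by rwa [zz]
    refine ⟨⟨conj π * w, S.mem_mul (S.cj _ _ hπ) hn' hw', ?_⟩, ⟨π * w, S.mem_mul hπ hn hw', ?_⟩⟩
    · simp only [← hn]; ring
    · simp only [← hn]; ring
  · rintro ⟨h1, h2⟩
    have h3 := S.splitI hp hπ hn ht hpt h1 h2
    have h4 : z ∈ TT L e (p * (p * m)) := by
      rw [S.splitU hp hπ hn hk]; exact Or.inl h1
    refine ⟨z / p, ⟨h3, ?_⟩, by field_simp⟩
    have h5 := h4.2
    rw [map_div₀, div_mul_div_comm, h5, map_natCast]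
    push_cast; field_simp

def UU (t p : ℤ) : ℕ → ℤ
  | 0 => 1
  | 1 => t
  | (n + 2) => t * UU t p (n + 1) - p ^ 2 * UU t p n

lemma UU_mod (t p : ℤ) : ∀ n, p ∣ UU t p n - t ^ n
  | 0 => by simp [UU]
  | 1 => by simp [UU]
  | (n + 2) => by
    obtain ⟨c, hc⟩ := UU_mod t p (n + 1)
    refine ⟨t * c - p * UU t p n, ?_⟩
    rw [UU]; linear_combination t * hc

lemma Sys.heckeU (S : Sys L) {e' : ZMod 2} {m p : ℕ} (hp : p.Prime) {π : ℂ} (hπ : π ∈ L e')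
    (hn : π * conj π = p) 
    (hk : ∀ e z, z ∈ L e → ∀ m : ℕ, z * conj z = p * m →
      z / π ∈ L (e + e') ∨ z / conj π ∈ L (e + e'))
    {t : ℤ} (ht : π ^ 2 + (conj π) ^ 2 = t) (hpt : ¬ (p : ℤ) ∣ t) (hm : ¬ p ∣ m) :
    ∀ (k : ℕ) (e : ZMod 2), GG L e (p ^ k * m) = UU t p k * GG L (e + k * e') m
  | 0, e => by simp [UU]
  | 1, e => by simpa [UU] using S.hecke1 hp hπ hn hk ht hpt hm
  | (k + 2), e => by
    have h1 := S.hecke2 (e := e) (m := p ^ k * m) hp hπ hn hk ht hpt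
    have h2 := S.heckeU hp hπ hn hk ht hpt hm (k + 1) (e + e')
    have h3 := S.heckeU hp hπ hn hk ht hpt hm k e
    have e1 : p ^ (k + 2) * m = p * (p * (p ^ k * m)) := by ring
    have e2 : p * (p ^ k * m) = p ^ (k + 1) * m := by ring
    have e3 : e + e' + ((k + 1 : ℕ) : ZMod 2) * e' = e + k * e' := by
      have := zz (e + k * e') e'
      push_cast; linear_combination this
    have e4 : e + ((k + 2 : ℕ) : ZMod 2) * e' = e + k * e' := by
      have := zz (e + k * e') e'
      push_cast; linear_combination this
    rw [e1, h1, e2, h2, h3, e3, e4, UU]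
    push_cast; ring

lemma Sys.neU (S : Sys L) {e' : ZMod 2} {m p : ℕ} (hp : p.Prime) {π : ℂ} (hπ : π ∈ L e')
    (hn : π * conj π = p) 
    (hk : ∀ e z, z ∈ L e → ∀ m : ℕ, z * conj z = p * m →
      z / π ∈ L (e + e') ∨ z / conj π ∈ L (e + e')) :
    ∀ (k : ℕ) (e : ZMod 2), (TT L e (p ^ k * m)).Nonempty → (TT L (e + k * e') m).Nonempty
  | 0, e => by simp
  | (k + 1), e => by
    intro h
    have e1 : p ^ (k + 1) * m = p * (p ^ k * m) := by ring
    rw [e1, S.splitU hp hπ hn hk] at h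
    have : (TT L (e + e') (p ^ k * m)).Nonempty := by
      rcases h with ⟨z, ⟨w, hw, _⟩ | ⟨w, hw, _⟩⟩ <;> exact ⟨w, hw⟩
    have h2 := S.neU hp hπ hn hk k (e + e') this
    convert h2 using 2
    push_cast; ring

theorem Sys.main (S : Sys L) : ∀ (m : ℕ), 0 < m → ∀ e : ZMod 2, (TT L e m).Nonempty → 
    GG L e m ≠ 0 := by
  intro m
  induction m using Nat.strong_induction_on with
  | _ m ih =>
  intro hm e hne
  by_cases h1 : m = 1
  · subst h1
    have : GG L e 1 = ∑ᶠ z ∈ TT L e 1, (1 : ℂ) := by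
      refine finsum_mem_congr rfl fun z hz => S.unit e z hz.1 (by simpa using hz.2)
    rw [this, finsum_mem_eq_finite_toFinset_sum _ (S.finT e 1)]
    simp only [Finset.sum_const, nsmul_eq_mul, mul_one, ne_eq, Nat.cast_eq_zero,
      Finset.card_eq_zero]
    rw [← ne_eq, ← Finset.nonempty_iff_ne_empty]
    simpa using hne
  · obtain ⟨p, hp, hpm⟩ := Nat.exists_prime_and_dvd h1
    have hp' : (p : ℂ) ≠ 0 := by exact_mod_cast hp.ne_zero
    rcases S.key p hp with hin | ⟨e', π, hπ, hn, hk⟩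
    · obtain ⟨n, rfl⟩ := hpm
      obtain ⟨z, hz⟩ := hne
      have hz2 := hz.2
      push_cast at hz2
      obtain ⟨l, hl⟩ := S.nrm _ _ (hin e z hz.1 n hz2)
      have hnl : n = p * l := by
        rw [map_div₀, div_mul_div_comm, hz2, map_natCast] at hl
        field_simp at hl
        exact_mod_cast hl
      subst hnl
      have himg : TT L e (p * (p * l)) = (fun z => (p : ℂ) * z) '' TT L e l := by
        ext w; constructor
        · intro hw
          have hw2 := hw.2
          refine ⟨w / p, ⟨hin e w hw.1 (p * l) (by simpa using hw2), ?_⟩, by field_simp⟩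
          rw [map_div₀, div_mul_div_comm, hw2, map_natCast]
          push_cast; field_simp
        · rintro ⟨w, hw, rfl⟩
          refine ⟨by simpa using (L e).nsmul_mem hw.1 p, ?_⟩
          have := hw.2
          simp only [map_mul, map_natCast]; push_cast; rw [← this]; ring
      have hne : (TT L e l).Nonempty := by
        have : (TT L e (p * (p * l))).Nonempty := ⟨z, hz⟩
        rw [himg] at this
        exact this.of_image
      have hl0 : 0 < l := by
        rcases Nat.eq_zero_or_pos l with h | h
        · simp [h] at hm
        · exact h
      have := hp.two_le
      have hlt : l < p * (p * l) := by nlinarith [Nat.mul_le_mul this (Nat.mul_le_mul this (le_refl l))]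
      have h5 := ih l hlt hl0 e hne
      have h6 : GG L e (p * (p * l)) = p ^ 2 * GG L e l := by
        rw [← S.smul_image _ _ _ hp', ← himg]; rfl
      rw [h6]
      exact mul_ne_zero (pow_ne_zero 2 hp') h5
    · obtain ⟨t, ht, hpt⟩ := S.tr e' π p hp hπ hn
      by_cases hd : (p : ℤ) ∣ t
      · have hr := hpt hd
        obtain ⟨n, rfl⟩ := hpm
        have himg := S.ram (e := e) (m := n) hp hπ hn hk hr
        have h0 : π ≠ 0 := by rintro rfl; simp at hn; exact hp' hn.symm
        have hne' : (TT L (e + e') n).Nonempty := by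
          rw [himg] at hne
          exact hne.of_image
        have hn0 : 0 < n := Nat.pos_of_mul_pos_left hm
        have h5 := ih n (by nlinarith [hp.two_le]) hn0 _ hne'
        have h6 : GG L e (p * n) = π ^ 2 * GG L (e + e') n := by
          rw [← S.smul_image _ _ _ h0, ← himg]; rfl
        rw [h6]
        exact mul_ne_zero (pow_ne_zero 2 h0) h5
      · obtain ⟨k, n, hpn, rfl⟩ := Nat.exists_eq_pow_mul_and_not_dvd hm.ne' p hp.ne_one
        have hn0 : 0 < n := Nat.pos_of_mul_pos_left hm
        have hk0 : k ≠ 0 := by rintro rfl; simp at hpm; exact hpn hpm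
        have hlt : n < p ^ k * n := by
          have := Nat.one_lt_pow hk0 hp.one_lt
          nlinarith
        rw [S.heckeU hp hπ hn hk ht hd hpn]
        refine mul_ne_zero ?_ (ih n hlt hn0 _ (S.neU hp hπ hn hk k e hne))
        intro h0
        have h0 : UU t p k = 0 := by exact_mod_cast h0
        have := UU_mod t p k
        rw [h0, zero_sub, dvd_neg] at this
        exact hd ((Nat.prime_iff_prime_int.mp hp).dvd_of_dvd_pow this)
end

section
open ComplexConjugate

def lat (a b : ℂ) : AddSubgroup ℂ where
  carrier := {z | ∃ u v : ℤ, z = u * a + v * b}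
  zero_mem' := ⟨0, 0, by simp⟩
  add_mem' := by
    rintro _ _ ⟨u, v, rfl⟩ ⟨u', v', rfl⟩
    exact ⟨u + u', v + v', by push_cast; ring⟩
  neg_mem' := by
    rintro _ ⟨u, v, rfl⟩
    exact ⟨-u, -v, by push_cast; ring⟩

lemma mem_lat {a b z : ℂ} : z ∈ lat a b ↔ ∃ u v : ℤ, z = u * a + v * b := Iff.rfl

noncomputable def LL (θ s : ℂ) (e : ZMod 2) : AddSubgroup ℂ :=
  if e = 0 then lat 1 θ else lat s (θ / s)

lemma mem0 {θ s z : ℂ} : z ∈ LL θ s 0 ↔ ∃ u v : ℤ, z = u + v * θ := by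
  simp [LL, mem_lat]

lemma mem1 {θ s z : ℂ} : z ∈ LL θ s 1 ↔ ∃ u v : ℤ, z = u * s + v * (θ / s) := by
  simp [LL, mem_lat]

lemma e01 (e : ZMod 2) : e = 0 ∨ e = 1 := by revert e; decide

structure Dat (P : ℕ) (k r : ℤ) (θ s : ℂ) : Prop where
  hP : P.Prime
  hr : ¬ (P : ℤ) ∣ r
  hθ : θ ^ 2 = P * k * θ - P * r
  cθ : conj θ = P * k - θ
  hs : s ^ 2 = P
  cs : conj s = s
  hΔ : 4 * (P : ℤ) < 4 * P * r - P ^ 2 * k ^ 2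
  sq1 : ¬ IsSquare (4 * P * r - P ^ 2 * k ^ 2)
  sq3 : ¬ IsSquare (3 * (4 * P * r - P ^ 2 * k ^ 2))
  red : ∀ a : ℤ, 0 < a → 3 * a ^ 2 ≤ 4 * P * r - P ^ 2 * k ^ 2 → ∀ b : ℤ, -a ≤ 2 * b + P * k →
    2 * b + P * k ≤ a → a ∣ b ^ 2 + P * k * b + P * r →
    a = 1 ∨ (a = P ∧ (P : ℤ) ∣ b) ∨ (a = r ∧ (r ∣ b ∨ r ∣ b + P * k))

variable {P : ℕ} {k r : ℤ} {θ s : ℂ}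

lemma Dat.P0 (D : Dat P k r θ s) : (P : ℂ) ≠ 0 := by exact_mod_cast D.hP.ne_zero
lemma Dat.s0 (D : Dat P k r θ s) : s ≠ 0 := by
  intro h; have := D.hs; rw [h] at this; simp at this; exact D.P0 this.symm

lemma Dat.n0 (D : Dat P k r θ s) (u v : ℤ) :
    ((u : ℂ) + v * θ) * conj ((u : ℂ) + v * θ) = ((u ^ 2 + P * k * u * v + P * r * v ^ 2 : ℤ) : ℂ) := by
  simp only [map_add, map_mul, D.cθ, map_intCast]
  push_cast
  linear_combination (- (v : ℂ) ^ 2) * D.hθ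

lemma Dat.n1 (D : Dat P k r θ s) (u v : ℤ) :
    ((u : ℂ) * s + v * (θ / s)) * conj ((u : ℂ) * s + v * (θ / s)) =
      ((P * u ^ 2 + P * k * u * v + r * v ^ 2 : ℤ) : ℂ) := by
  have hs := D.s0
  have hP := D.P0
  simp only [map_add, map_mul, map_div₀, D.cθ, D.cs, map_intCast]
  push_cast
  have e1 : ((u : ℂ) * s + v * (θ / s)) * (u * s + v * ((P * k - θ) / s)) =
    u ^ 2 * s ^ 2 + u * v * P * k + v ^ 2 * (P * k * θ - θ ^ 2) / s ^ 2 := by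
    field_simp; ring
  rw [e1, D.hs, D.hθ]; field_simp; ring

lemma Dat.r0 (D : Dat P k r θ s) : 0 < r := by
  have := D.hΔ
  have hP : 0 < (P : ℤ) := by exact_mod_cast D.hP.pos
  by_contra h
  push Not at h
  nlinarith [sq_nonneg ((P : ℤ) * k), mul_nonneg hP.le (neg_nonneg.mpr h)]

lemma Dat.mul (D : Dat P k r θ s) : ∀ e f x y, x ∈ LL θ s e → y ∈ LL θ s f → x * y ∈ LL θ s (e + f) := by
  have hs := D.s0
  have hP := D.P0
  have h00 : ∀ x y, x ∈ LL θ s 0 → y ∈ LL θ s 0 → x * y ∈ LL θ s 0 := by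
    intro x y hx hy
    rw [mem0] at *
    obtain ⟨u, v, rfl⟩ := hx
    obtain ⟨u', v', rfl⟩ := hy
    refine ⟨u * u' - P * r * v * v', u * v' + u' * v + P * k * v * v', ?_⟩
    push_cast
    linear_combination (v * v' : ℂ) * D.hθ
  have h01 : ∀ x y, x ∈ LL θ s 0 → y ∈ LL θ s 1 → x * y ∈ LL θ s 1 := by
    intro x y hx hy
    rw [mem0] at hx
    rw [mem1] at *
    obtain ⟨u, v, rfl⟩ := hx
    obtain ⟨u', v', rfl⟩ := hy
    refine ⟨u * u' - r * v * v', u * v' + P * u' * v + P * k * v * v', ?_⟩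
    have : θ ^ 2 = s ^ 2 * k * θ - s ^ 2 * r := by rw [D.hs, D.hθ]
    push_cast
    rw [← D.hs]
    field_simp
    linear_combination (v * v' : ℂ) * this
  have h11 : ∀ x y, x ∈ LL θ s 1 → y ∈ LL θ s 1 → x * y ∈ LL θ s 0 := by
    intro x y hx hy
    rw [mem1] at hx hy
    rw [mem0]
    obtain ⟨u, v, rfl⟩ := hx
    obtain ⟨u', v', rfl⟩ := hy
    refine ⟨P * u * u' - r * v * v', u * v' + u' * v + k * v * v', ?_⟩
    have : θ ^ 2 = s ^ 2 * k * θ - s ^ 2 * r := by rw [D.hs, D.hθ]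
    push_cast
    rw [← D.hs]
    field_simp
    linear_combination (v * v' : ℂ) * this
  intro e f x y hx hy
  rcases e01 e with rfl | rfl <;> rcases e01 f with rfl | rfl
  · exact h00 x y hx hy
  · rw [zero_add]; exact h01 x y hx hy
  · rw [add_zero, mul_comm]; exact h01 y x hy hx
  · exact h11 x y hx hy

lemma Dat.cj (D : Dat P k r θ s) : ∀ e x, x ∈ LL θ s e → conj x ∈ LL θ s e := by
  have hs := D.s0
  intro e x hx
  rcases e01 e with rfl | rfl
  · rw [mem0] at *
    obtain ⟨u, v, rfl⟩ := hx
    refine ⟨u + P * k * v, -v, ?_⟩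
    simp only [map_add, map_mul, D.cθ, map_intCast]
    push_cast; ring
  · rw [mem1] at *
    obtain ⟨u, v, rfl⟩ := hx
    refine ⟨u + k * v, -v, ?_⟩
    simp only [map_add, map_mul, map_div₀, D.cθ, D.cs, map_intCast]
    push_cast; rw [← D.hs]; field_simp; ring

lemma nat_of (z : ℂ) (n : ℤ) (h : z * conj z = n) : ∃ m : ℕ, z * conj z = m := by
  have h1 : 0 ≤ n := by
    rw [Complex.mul_conj] at h
    have : Complex.normSq z = (n : ℝ) := by exact_mod_cast h
    have h2 := Complex.normSq_nonneg z
    rw [this] at h2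
    exact_mod_cast h2
  lift n to ℕ using h1
  exact ⟨n, by simpa using h⟩

lemma Dat.nrm (D : Dat P k r θ s) : ∀ e x, x ∈ LL θ s e → ∃ n : ℕ, x * conj x = n := by
  intro e x hx
  rcases e01 e with rfl | rfl
  · rw [mem0] at *
    obtain ⟨u, v, rfl⟩ := hx
    exact nat_of _ _ (D.n0 u v)
  · rw [mem1] at *
    obtain ⟨u, v, rfl⟩ := hx
    exact nat_of _ _ (D.n1 u v)

lemma Dat.fin (D : Dat P k r θ s) : ∀ e (m : ℕ), {z | z ∈ LL θ s e ∧ z * conj z = m}.Finite := by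
  have hs := D.s0
  have h0 : ∀ m : ℕ, {z | z ∈ LL θ s 0 ∧ z * conj z = m}.Finite := by
    intro m
    refine Set.Finite.subset (((Set.finite_Icc (-(4 * m : ℤ)) (4 * m)).prod 
      (Set.finite_Icc (-(4 * m : ℤ)) (4 * m))).image 
      (fun q : ℤ × ℤ => ((q.1 : ℂ) - P * k * q.2) / 2 + q.2 * θ)) ?_
    rintro z ⟨hz, hn⟩
    rw [mem0] at hz
    obtain ⟨u, v, rfl⟩ := hz
    rw [D.n0] at hn
    have hn : u ^ 2 + P * k * u * v + P * r * v ^ 2 = (m : ℤ) := by exact_mod_cast hn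
    have hn' : (2 * u + P * k * v) ^ 2 + (4 * P * r - P ^ 2 * k ^ 2) * v ^ 2 = 4 * m := by
      linear_combination 4 * hn
    have hD : 1 ≤ (4 * P * r - P ^ 2 * k ^ 2) := by have := D.hΔ; omega
    have hv : v ^ 2 ≤ 4 * m := by nlinarith [sq_nonneg v, sq_nonneg (2 * u + P * k * v)]
    have hu : (2 * u + P * k * v) ^ 2 ≤ 4 * m := by nlinarith [sq_nonneg v]
    have aux : ∀ w : ℤ, w ^ 2 ≤ 4 * m → w ∈ Set.Icc (-(4 * m : ℤ)) (4 * m) := by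
      intro w hw
      have := Int.le_self_sq w
      have h2 := Int.le_self_sq (-w)
      rw [neg_sq] at h2
      exact Set.mem_Icc.mpr ⟨by linarith, by linarith⟩
    refine ⟨(2 * u + P * k * v, v), ⟨aux _ hu, aux _ hv⟩, ?_⟩
    push_cast; ring
  intro e m
  rcases e01 e with rfl | rfl
  · exact h0 m
  · refine Set.Finite.subset ((h0 (P * m)).image (fun z => z / s)) ?_
    rintro z ⟨hz, hn⟩
    refine ⟨z * s, ⟨?_, ?_⟩, by field_simp⟩
    · refine D.mul 1 1 z s hz ?_
      rw [mem1]; exact ⟨1, 0, by simp⟩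
    · rw [map_mul, D.cs]; push_cast; rw [← hn, ← D.hs]; ring

lemma Dat.unit (D : Dat P k r θ s) : ∀ e z, z ∈ LL θ s e → z * conj z = 1 → z ^ 2 = 1 := by
  have hP : 2 ≤ (P : ℤ) := by exact_mod_cast D.hP.two_le
  have hD := D.hΔ
  intro e z hz hn
  rcases e01 e with rfl | rfl
  · rw [mem0] at *
    obtain ⟨u, v, rfl⟩ := hz
    rw [D.n0] at hn
    have hn : u ^ 2 + P * k * u * v + P * r * v ^ 2 = 1 := by exact_mod_cast hn
    have hn' : (2 * u + P * k * v) ^ 2 + (4 * P * r - P ^ 2 * k ^ 2) * v ^ 2 = 4 := by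
      linear_combination 4 * hn
    have hv : v = 0 := by
      by_contra h
      have : 0 < v ^ 2 := by positivity
      nlinarith [sq_nonneg (2 * u + P * k * v)]
    subst hv
    have : u ^ 2 = 1 := by linarith
    have : (u : ℂ) ^ 2 = 1 := by exact_mod_cast this
    simpa using this
  · exfalso
    rw [mem1] at *
    obtain ⟨u, v, rfl⟩ := hz
    rw [D.n1] at hn
    have hn : P * u ^ 2 + P * k * u * v + r * v ^ 2 = 1 := by exact_mod_cast hn
    have hn' : (2 * P * u + P * k * v) ^ 2 + (4 * P * r - P ^ 2 * k ^ 2) * v ^ 2 = 4 * P := by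
      linear_combination 4 * P * hn
    have hv : v = 0 := by
      by_contra h
      have : 0 < v ^ 2 := by positivity
      nlinarith [sq_nonneg (2 * P * u + P * k * v)]
    subst hv
    have h1 : P * u ^ 2 = 1 := by linarith
    have : (P : ℤ) ∣ 1 := ⟨_, h1.symm⟩
    have := Int.le_of_dvd one_pos this
    omega

lemma Dat.tr (D : Dat P k r θ s) : ∀ e z (p : ℕ), p.Prime → z ∈ LL θ s e → z * conj z = p →
    ∃ t : ℤ, z ^ 2 + (conj z) ^ 2 = t ∧ ((p : ℤ) ∣ t → conj z = z ∨ conj z = - z) := by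
  intro e z p hp hz hn
  have hp0 : 0 < (p : ℤ) := by exact_mod_cast hp.pos
  have h2 : z * z ∈ LL θ s 0 := by
    have := D.mul e e z z hz hz
    have he : e + e = 0 := by simpa using zz 0 e
    rwa [he] at this
  rw [mem0] at h2
  obtain ⟨U, V, hUV⟩ := h2
  have hc : conj z * conj z = U + V * (P * k - θ) := by
    rw [← map_mul, hUV]
    simp only [map_add, map_mul, D.cθ, map_intCast]
  have hN := D.n0 U V
  rw [← hUV, map_mul] at hN
  have hN' : ((p ^ 2 : ℤ) : ℂ) = ((U ^ 2 + P * k * U * V + P * r * V ^ 2 : ℤ) : ℂ) := by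
    rw [← hN]; push_cast; rw [← hn]; ring
  have hN2 : (p ^ 2 : ℤ) = (U ^ 2 + P * k * U * V + P * r * V ^ 2 : ℤ) := by exact_mod_cast hN'
  refine ⟨2 * U + P * k * V, by push_cast; linear_combination hUV + hc, ?_⟩
  rintro ⟨j, hj⟩
  have hDV : (4 * P * r - P ^ 2 * k ^ 2) * V ^ 2 = (4 - j ^ 2) * p ^ 2 := by
    linear_combination (-4) * hN2 - (2 * U + P * k * V + p * j) * hj
  have hD := D.hΔ
  have hDp : 0 < (4 * P * r - P ^ 2 * k ^ 2) := by omega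
  have hsq : ∀ c : ℤ, (4 * P * r - P ^ 2 * k ^ 2) * V ^ 2 = c * p ^ 2 → 
      IsSquare (c * (4 * P * r - P ^ 2 * k ^ 2)) := by
    intro c hc
    set Δ := (4 * P * r - P ^ 2 * k ^ 2)
    have h1 : (Δ * V) ^ 2 = c * Δ * p ^ 2 := by linear_combination Δ * hc
    have h3 : (p : ℤ) ^ 2 ∣ (Δ * V) ^ 2 := ⟨c * Δ, by rw [h1]; ring⟩
    rw [Int.pow_dvd_pow_iff two_ne_zero] at h3
    obtain ⟨w, hw⟩ := h3
    refine ⟨w, ?_⟩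
    rw [hw] at h1
    have : (p : ℤ) ^ 2 * (c * Δ) = p ^ 2 * (w * w) := by linear_combination -h1
    exact mul_left_cancel₀ (by positivity) this
  have hj4 : j ^ 2 ≤ 4 := by
    by_contra h
    push Not at h
    have : 0 < (p : ℤ) ^ 2 := by positivity
    nlinarith [mul_nonneg hDp.le (sq_nonneg V)]
  have hj2 : j ≤ 2 := by nlinarith
  have hj2' : -2 ≤ j := by nlinarith
  have hfin : j ^ 2 = 4 → conj z = z ∨ conj z = - z := by
    intro h
    rw [h] at hDV
    have hV : V = 0 := by
      rw [sub_self, zero_mul] at hDV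
      rcases mul_eq_zero.mp hDV with h | h
      · omega
      · exact pow_eq_zero_iff two_ne_zero |>.mp h
    subst hV
    have : conj z * conj z = z * z := by rw [hc, hUV]; simp
    exact mul_self_eq_mul_self_iff.mp this
  have h3 : j ^ 2 = 1 → conj z = z ∨ conj z = - z := by
    intro h
    rw [h] at hDV
    exact absurd (hsq 3 (by linarith)) D.sq3
  have h4 : j = 0 → conj z = z ∨ conj z = - z := by
    rintro rfl
    obtain ⟨w, hw⟩ := hsq 4 (by linarith)
    exfalso
    have h5 : (2 : ℤ) ^ 2 ∣ w ^ 2 := ⟨4 * P * r - P ^ 2 * k ^ 2, by rw [sq, ← hw]; ring⟩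
    rw [Int.pow_dvd_pow_iff two_ne_zero] at h5
    obtain ⟨x, rfl⟩ := h5
    exact D.sq1 ⟨x, by linarith⟩
  interval_cases j
  · exact hfin rfl
  · exact h3 rfl
  · exact h4 rfl
  · exact h3 rfl
  · exact hfin rfl

lemma Dat.sm (_D : Dat P k r θ s) : s ∈ LL θ s 1 := by rw [mem1]; exact ⟨1, 0, by simp⟩

lemma Dat.bkey (D : Dat P k r θ s) : ∀ a : ℕ, 0 < a → ∀ b : ℤ, (a : ℤ) ∣ b ^ 2 + P * k * b + P * r →
    ∃ e x y, x ∈ LL θ s e ∧ y ∈ LL θ s e ∧ x * conj x = a ∧ x * y = b + θ := by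
  have hs := D.s0
  have hP := D.P0
  intro a
  induction a using Nat.strong_induction_on with
  | _ a ih =>
  intro ha
  have ha' : 0 < (a : ℤ) := by exact_mod_cast ha
  have haC : (a : ℂ) ≠ 0 := by exact_mod_cast ha.ne'
  -- reduced b suffices
  suffices H : ∀ b : ℤ, -(a : ℤ) ≤ 2 * b + P * k → 2 * b + P * k ≤ a → 
      (a : ℤ) ∣ b ^ 2 + P * k * b + P * r →
      ∃ e x y, x ∈ LL θ s e ∧ y ∈ LL θ s e ∧ x * conj x = a ∧ x * y = b + θ by
    intro b hb
    set q := (2 * b + P * k + a) / (2 * a) with hq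
    have h1 := Int.emod_nonneg (2 * b + P * k + a) (b := 2 * a) (by omega)
    have h2 := Int.emod_lt_of_pos (2 * b + P * k + a) (b := 2 * a) (by omega)
    have h3 := Int.emod_add_mul_ediv (2 * b + P * k + a) (2 * a)
    rw [← hq] at h3
    obtain ⟨e, x, y, hx, hy, hxx, hxy⟩ := H (b - a * q) (by linarith) (by linarith) (by
      obtain ⟨c, hc⟩ := hb
      exact ⟨c - 2 * b * q + a * q ^ 2 - P * k * q, by linear_combination hc⟩)
    refine ⟨e, x, y + q • conj x, hx, (LL θ s e).add_mem hy ((LL θ s e).zsmul_mem (D.cj e x hx) q),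
      hxx, ?_⟩
    push_cast at hxy
    rw [zsmul_eq_mul]
    linear_combination hxy + q * hxx
  intro b hb1 hb2 hb
  obtain ⟨c, hc⟩ := id hb
  have hN := D.n0 b 1
  by_cases hca : c < a
  · have hc0 : 0 < c := by
      have h4 : 0 < 4 * (a * c) := by
        rw [← hc]
        have := D.hΔ
        nlinarith [sq_nonneg (2 * b + P * k)]
      nlinarith
    lift c to ℕ using hc0.le
    obtain ⟨e, x, y, hx, hy, hxx, hxy⟩ := ih c (by exact_mod_cast hca) (by exact_mod_cast hc0)
      (-b - P * k) ⟨a, by linear_combination hc⟩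
    have hcC : (c : ℂ) ≠ 0 := by exact_mod_cast hc0.ne'
    have hcxy : conj x * conj y = -(b + θ) := by
      rw [← map_mul, hxy]
      simp only [map_add, D.cθ, map_intCast]
      push_cast; ring
    refine ⟨e, conj y, - conj x, D.cj _ _ hy, (LL θ s e).neg_mem (D.cj _ _ hx), ?_, ?_⟩
    · have h6 : (c : ℂ) * (conj y * conj (conj y)) = c * a := by
        rw [Complex.conj_conj, ← hxx]
        have hcc : (b : ℂ) ^ 2 + P * k * b + P * r = a * c := by exact_mod_cast hc
        have : (x * conj x) * (conj y * y) = (x * y) * (conj x * conj y) := by ring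
        rw [this, hxy, hcxy, hxx]
        push_cast
        linear_combination hcc - D.hθ
      exact mul_left_cancel₀ hcC h6
    · linear_combination -hcxy
  · push Not at hca
    have h3 : 3 * (a : ℤ) ^ 2 ≤ 4 * P * r - P ^ 2 * k ^ 2 := by
      have : (2 * b + P * k) ^ 2 ≤ (a : ℤ) ^ 2 := by
        apply sq_le_sq' <;> assumption
      nlinarith
    rcases D.red a ha' h3 b hb1 hb2 hb with h | ⟨h, j, hj⟩ | ⟨h, ⟨j, hj⟩ | ⟨j, hj⟩⟩
    · have h : a = 1 := by exact_mod_cast h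
      subst h
      exact ⟨0, 1, b + θ, mem0.mpr ⟨1, 0, by simp⟩, mem0.mpr ⟨b, 1, by simp⟩, by simp, by simp⟩
    · have h : a = P := by exact_mod_cast h
      subst h
      refine ⟨1, s, j * s + θ / s, D.sm, mem1.mpr ⟨j, 1, by simp⟩, ?_, ?_⟩
      · rw [D.cs, ← D.hs, sq]
      · rw [hj]; push_cast; rw [← D.hs]; field_simp
    · refine ⟨1, θ / s, s * (j * k + 1) - j * (θ / s), mem1.mpr ⟨0, 1, by simp⟩, 
        mem1.mpr ⟨j * k + 1, -j, by push_cast; ring⟩, ?_, ?_⟩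
      · have := D.n1 0 1
        simp at this
        rw [map_div₀, this]; exact_mod_cast h.symm
      · have : θ ^ 2 = s ^ 2 * k * θ - s ^ 2 * r := by rw [D.hs, D.hθ]
        rw [hj]; push_cast; field_simp
        linear_combination (-(j : ℂ)) * this
    · refine ⟨1, k * s - θ / s, -s + j * (θ / s), mem1.mpr ⟨k, -1, by push_cast; ring⟩, 
        mem1.mpr ⟨-1, j, by push_cast; ring⟩, ?_, ?_⟩
      · have := D.n1 k (-1)
        have e1 : (k : ℂ) * s - θ / s = k * s + ((-1 : ℤ) : ℂ) * (θ / s) := by push_cast; ring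
        rw [e1, this]
        have : ((a : ℤ) : ℂ) = (r : ℂ) := by rw [h]
        push_cast at this ⊢
        rw [this]; ring
      · have : θ ^ 2 = s ^ 2 * k * θ - s ^ 2 * r := by rw [D.hs, D.hθ]
        have hj' : (b : ℂ) + s ^ 2 * k = r * j := by rw [D.hs]; exact_mod_cast hj
        field_simp
        linear_combination (-(j : ℂ)) * this + (-(s ^ 2)) * hj' 

lemma Dat.key (D : Dat P k r θ s) : ∀ p : ℕ, p.Prime →
    (∀ e z, z ∈ LL θ s e → ∀ m : ℕ, z * conj z = p * m → z / p ∈ LL θ s e) ∨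
    ∃ e' π, π ∈ LL θ s e' ∧ π * conj π = p ∧ ∀ e z, z ∈ LL θ s e → ∀ m : ℕ, z * conj z = p * m →
      z / π ∈ LL θ s (e + e') ∨ z / conj π ∈ LL θ s (e + e') := by
  intro p hp
  have hs := D.s0
  have hP := D.P0
  have hpC : (p : ℂ) ≠ 0 := by exact_mod_cast hp.ne_zero
  have hpI : Prime (p : ℤ) := Nat.prime_iff_prime_int.mp hp
  have hPI : Prime (P : ℤ) := Nat.prime_iff_prime_int.mp D.hP
  by_cases hpP : p = P
  · subst hpP
    right
    refine ⟨1, s, D.sm, by rw [D.cs, ← D.hs, sq], ?_⟩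
    intro e z hz m hm
    left
    rcases e01 e with rfl | rfl
    · rw [mem0] at hz
      rw [zero_add, mem1]
      obtain ⟨u, v, rfl⟩ := hz
      rw [D.n0] at hm
      have hm : u ^ 2 + p * k * u * v + p * r * v ^ 2 = (p : ℤ) * m := by exact_mod_cast hm
      have : (p : ℤ) ∣ u ^ 2 := ⟨m - k * u * v - r * v ^ 2, by linear_combination hm⟩
      obtain ⟨w, rfl⟩ := hpI.dvd_of_dvd_pow this
      refine ⟨w, v, ?_⟩
      push_cast; rw [← D.hs]; field_simp
    · rw [mem1] at hz
      change _ ∈ LL θ s 0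
      rw [mem0]
      obtain ⟨u, v, rfl⟩ := hz
      rw [D.n1] at hm
      have hm : p * u ^ 2 + p * k * u * v + r * v ^ 2 = (p : ℤ) * m := by exact_mod_cast hm
      have : (p : ℤ) ∣ r * v ^ 2 := ⟨m - k * u * v - u ^ 2, by linear_combination hm⟩
      have := (hpI.dvd_or_dvd this).resolve_left D.hr
      obtain ⟨w, rfl⟩ := hpI.dvd_of_dvd_pow this
      refine ⟨u, w, ?_⟩
      push_cast; rw [← D.hs]; field_simp
  have hndvd : ¬ (p : ℤ) ∣ (P : ℤ) := by
    intro h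
    have h : p ∣ P := by exact_mod_cast h
    exact hpP ((Nat.prime_dvd_prime_iff_eq hp D.hP).mp h)
  by_cases hroot : ∃ b : ℤ, (p : ℤ) ∣ b ^ 2 + P * k * b + P * r
  · right
    obtain ⟨b, hb⟩ := hroot
    obtain ⟨e', π, y, hπ, hy, hn, hxy⟩ := D.bkey p hp.pos b hb
    have h0 : π ≠ 0 := by rintro rfl; simp at hn; exact hpC hn.symm
    have h0' : conj π ≠ 0 := by simpa using h0
    have hxy' : conj π * conj y = b + P * k - θ := by
      rw [← map_mul, hxy]
      simp only [map_add, D.cθ, map_intCast]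
      ring
    refine ⟨e', π, hπ, hn, ?_⟩
    have h00 : ∀ z, z ∈ LL θ s 0 → ∀ m : ℕ, z * conj z = p * m →
        z / π ∈ LL θ s e' ∨ z / conj π ∈ LL θ s e' := by
      intro z hz m hm
      rw [mem0] at hz
      obtain ⟨u, v, rfl⟩ := hz
      rw [D.n0] at hm
      have hm : u ^ 2 + P * k * u * v + P * r * v ^ 2 = (p : ℤ) * m := by exact_mod_cast hm
      obtain ⟨c, hc⟩ := hb
      have hd : (p : ℤ) ∣ (u - b * v) * (u + b * v + P * k * v) :=
        ⟨m - v ^ 2 * c, by linear_combination hm - v ^ 2 * hc⟩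
      rcases hpI.dvd_or_dvd hd with ⟨j, hj⟩ | ⟨j, hj⟩
      · left
        have : ((u : ℂ) + v * θ) / π = v • y + j • conj π := by
          have hj : (u : ℂ) - b * v = p * j := by exact_mod_cast hj
          simp only [zsmul_eq_mul]
          field_simp
          linear_combination hj - v * hxy - j * hn
        rw [this]
        exact (LL θ s e').add_mem ((LL θ s e').zsmul_mem hy v) 
          ((LL θ s e').zsmul_mem (D.cj _ _ hπ) j)
      · right
        have : ((u : ℂ) + v * θ) / conj π = (-v) • conj y + j • π := by
          have hj : (u : ℂ) + b * v + P * k * v = p * j := by exact_mod_cast hj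
          simp only [zsmul_eq_mul]
          push_cast
          field_simp
          linear_combination hj + v * hxy' - j * hn
        rw [this]
        exact (LL θ s e').add_mem ((LL θ s e').zsmul_mem (D.cj _ _ hy) (-v)) 
          ((LL θ s e').zsmul_mem hπ j)
    intro e z hz m hm
    rcases e01 e with rfl | rfl
    · rw [zero_add]; exact h00 z hz m hm
    · have h1 : s * z ∈ LL θ s 0 := D.mul 1 1 s z D.sm hz
      have h2 : (s * z) * conj (s * z) = p * ((P * m : ℕ) : ℂ) := by
        rw [map_mul, D.cs]; push_cast; rw [← D.hs]; linear_combination s ^ 2 * hm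
      rcases h00 _ h1 _ h2 with h | h
      · left
        refine Sys.bez _ _ p hp P hndvd ?_ ?_
        · have := D.mul 1 e' s _ D.sm h
          convert this using 1
          push_cast
          rw [← D.hs]; ring
        · have := D.mul 1 e' z _ hz (D.cj _ _ hπ)
          convert this using 1
          rw [← hn]; field_simp
      · right
        refine Sys.bez _ _ p hp P hndvd ?_ ?_
        · have := D.mul 1 e' s _ D.sm h
          convert this using 1
          push_cast
          rw [← D.hs]; ring
        · have := D.mul 1 e' z _ hz hπ
          convert this using 1
          rw [← hn]; field_simp
  · left
    have h00 : ∀ z, z ∈ LL θ s 0 → ∀ m : ℕ, z * conj z = p * m → z / p ∈ LL θ s 0 := by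
      intro z hz m hm
      rw [mem0] at hz ⊢
      obtain ⟨u, v, rfl⟩ := hz
      rw [D.n0] at hm
      have hm : u ^ 2 + P * k * u * v + P * r * v ^ 2 = (p : ℤ) * m := by exact_mod_cast hm
      by_cases hv : (p : ℤ) ∣ v
      · obtain ⟨w, rfl⟩ := hv
        have : (p : ℤ) ∣ u ^ 2 := ⟨m - P * k * u * w - P * r * p * w ^ 2, by linear_combination hm⟩
        obtain ⟨x, rfl⟩ := hpI.dvd_of_dvd_pow this
        exact ⟨x, w, by push_cast; field_simp⟩
      · exfalso
        obtain ⟨α, β, hab⟩ := hpI.coprime_iff_not_dvd.mpr hv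
        apply hroot
        refine ⟨u * β, β ^ 2 * m + α * (P * k * u * β + P * r * (1 + β * v)), ?_⟩
        linear_combination β ^ 2 * hm + (-(P * k * u * β + P * r * (1 + β * v))) * hab
    intro e z hz m hm
    rcases e01 e with rfl | rfl
    · exact h00 z hz m hm
    · have h1 : s * z ∈ LL θ s 0 := D.mul 1 1 s z D.sm hz
      have h2 : (s * z) * conj (s * z) = p * ((P * m : ℕ) : ℂ) := by
        rw [map_mul, D.cs]; push_cast; rw [← D.hs]; linear_combination s ^ 2 * hm
      have h := h00 _ h1 _ h2
      refine Sys.bez _ _ p hp P hndvd ?_ ?_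
      · have := D.mul 1 0 s _ D.sm h
        rw [add_zero] at this
        convert this using 1
        push_cast
        rw [← D.hs]; ring
      · convert hz using 1
        field_simp

lemma Dat.sys (D : Dat P k r θ s) : Sys (LL θ s) :=
  ⟨D.mul, D.cj, D.nrm, D.fin, D.unit, D.key, D.tr⟩
end

section
open ComplexConjugate

lemma GG_im {L : ZMod 2 → AddSubgroup ℂ} (S : Sys L) (e : ZMod 2) (m : ℕ) : (GG L e m).im = 0 := by
  rw [← Complex.conj_eq_iff_im]
  have h1 : conj (GG L e m) = ∑ᶠ z ∈ TT L e m, conj (z ^ 2) :=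
    (starRingEnd ℂ).toAddMonoidHom.map_finsum_mem _ (S.finT e m)
  rw [h1]
  have himg : TT L e m = (fun z => conj z) '' TT L e m := by
    ext z; constructor
    · intro hz
      exact ⟨conj z, ⟨S.cj _ _ hz.1, by rw [Complex.conj_conj, mul_comm]; exact hz.2⟩, by simp⟩
    · rintro ⟨w, hw, rfl⟩
      exact ⟨S.cj _ _ hw.1, by rw [Complex.conj_conj, mul_comm]; exact hw.2⟩
  unfold GG
  conv_rhs => rw [himg]
  rw [finsum_mem_image (fun a _ b _ h => (starRingEnd ℂ).injective h)]
  simp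

lemma final_aux {P : ℕ} {k r : ℤ} {θ s : ℂ} (D : Dat P k r θ s) (d m : ℕ) (hm : 0 < m) (sh : ℤ)
    (ω : ℂ) (hω : θ = sh + ω) (him : ω.im ≠ 0)
    (hQ : ∀ a b : ℤ, ((a : ℂ) + b * ω) * conj ((a : ℂ) + b * ω) = (Qf d (a, b) : ℂ))
    (hV : ∀ a b : ℤ, (((a : ℂ) + b * ω) ^ 2).re = ((Vf d (a, b) : ℚ) : ℝ))
    (hne : (shell d m).Nonempty) : (∑ᶠ p ∈ shell d m, Vf d p) ≠ 0 := by
  have himg : TT (LL θ s) 0 m = (fun p : ℤ × ℤ => (p.1 : ℂ) + p.2 * ω) '' shell d m := by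
    ext z; constructor
    · rintro ⟨hz, hn⟩
      rw [mem0] at hz
      obtain ⟨u, v, rfl⟩ := hz
      have e1 : (u : ℂ) + v * θ = ((u + sh * v : ℤ) : ℂ) + v * ω := by
        rw [hω]; push_cast; ring
      refine ⟨(u + sh * v, v), ?_, e1.symm⟩
      rw [e1, hQ] at hn
      change Qf d _ = (m : ℤ)
      exact_mod_cast hn
    · rintro ⟨⟨a, b⟩, hp, rfl⟩
      refine ⟨mem0.mpr ⟨a - sh * b, b, ?_⟩, ?_⟩
      · rw [hω]; push_cast; ring
      · simp only
        rw [hQ]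
        have : Qf d (a, b) = (m : ℤ) := hp
        rw [this]; simp
  have hinj : Set.InjOn (fun p : ℤ × ℤ => (p.1 : ℂ) + p.2 * ω) (shell d m) := by
    rintro ⟨a, b⟩ _ ⟨a', b'⟩ _ h
    simp only at h
    have h1 := congrArg Complex.im h
    simp [him] at h1
    subst h1
    simpa using h
  have hfin : (shell d m).Finite := by
    have := D.sys.finT 0 m
    rw [himg] at this
    exact this.of_finite_image hinj
  have hG := D.sys.main m hm 0 (by rw [himg]; exact hne.image _)
  intro h0
  apply hG
  apply Complex.ext
  · have h1 : (GG (LL θ s) 0 m).re = ∑ᶠ z ∈ TT (LL θ s) 0 m, (z ^ 2).re :=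
      Complex.reAddGroupHom.map_finsum_mem _ (D.sys.finT 0 m)
    rw [h1, himg, finsum_mem_image hinj]
    have h2 : ((∑ᶠ p ∈ shell d m, Vf d p : ℚ) : ℝ) = ∑ᶠ p ∈ shell d m, ((Vf d p : ℚ) : ℝ) :=
      (Rat.castHom ℝ).toAddMonoidHom.map_finsum_mem _ hfin
    rw [h0] at h2
    rw [Complex.zero_re]
    have h3 : ((0 : ℚ) : ℝ) = 0 := by simp
    rw [← h3, h2]
    exact finsum_mem_congr rfl fun p _ => hV p.1 p.2
  · exact GG_im D.sys 0 m

/-- Numerical data. -/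
structure NumDat (d P : ℕ) (k r sh : ℤ) : Prop where
  hd : 0 < d
  hP : P.Prime
  hr : ¬ (P : ℤ) ∣ r
  hΔ : 4 * (P : ℤ) < 4 * P * r - P ^ 2 * k ^ 2
  sq1 : ¬ IsSquare (4 * P * r - P ^ 2 * k ^ 2)
  sq3 : ¬ IsSquare (3 * (4 * P * r - P ^ 2 * k ^ 2))
  hle : 4 * P * r - P ^ 2 * k ^ 2 < 507
  hPk : 0 ≤ P * k ∧ P * k ≤ 13
  red : ∀ a ∈ Finset.Icc (1 : ℤ) 12, 3 * a ^ 2 ≤ 4 * P * r - P ^ 2 * k ^ 2 →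
    ∀ b ∈ Finset.Icc (-13 : ℤ) 6, -a ≤ 2 * b + P * k →
    2 * b + P * k ≤ a → a ∣ b ^ 2 + P * k * b + P * r →
    a = 1 ∨ (a = P ∧ (P : ℤ) ∣ b) ∨ (a = r ∧ (r ∣ b ∨ r ∣ b + P * k))
  mt : (d % 4 ≠ 3 ∧ P * k = 2 * sh ∧ 4 * P * r - P ^ 2 * k ^ 2 = 4 * d) ∨
    (d % 4 = 3 ∧ P * k = 2 * sh + 1 ∧ 4 * P * r - P ^ 2 * k ^ 2 = d)

lemma NumDat.final {d P : ℕ} {k r sh : ℤ} (N : NumDat d P k r sh) (m : ℕ) (hm : 0 < m)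
    (hne : (shell d m).Nonempty) : (∑ᶠ p ∈ shell d m, Vf d p) ≠ 0 := by
  set s : ℂ := ((Real.sqrt P : ℝ) : ℂ) with hs
  have hs2 : s ^ 2 = P := by
    rw [hs, ← Complex.ofReal_pow, Real.sq_sqrt (Nat.cast_nonneg P)]; simp
  have hcs : conj s = s := Complex.conj_ofReal _
  set R : ℝ := Real.sqrt d with hR
  have hR2 : R ^ 2 = d := Real.sq_sqrt (Nat.cast_nonneg d)
  have hR0 : R ≠ 0 := by
    intro h; rw [h] at hR2
    have := N.hd
    have h2 : (d : ℝ) = 0 := by rw [← hR2]; simp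
    have h3 : d = 0 := by exact_mod_cast h2
    omega
  set w : ℂ := (R : ℂ) * Complex.I with hw
  have hw2 : w ^ 2 = -d := by
    rw [hw, mul_pow, Complex.I_sq, ← Complex.ofReal_pow, hR2]; simp
  have hcw : conj w = -w := by rw [hw]; simp
  have hred : ∀ a : ℤ, 0 < a → 3 * a ^ 2 ≤ 4 * P * r - P ^ 2 * k ^ 2 → ∀ b : ℤ,
      -a ≤ 2 * b + P * k → 2 * b + P * k ≤ a → a ∣ b ^ 2 + P * k * b + P * r →
      a = 1 ∨ (a = P ∧ (P : ℤ) ∣ b) ∨ (a = r ∧ (r ∣ b ∨ r ∣ b + P * k)) := by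
    intro a ha h3 b h1 h2 h4
    have := N.hle
    have := N.hPk
    have ha12 : a ≤ 12 := by nlinarith
    exact N.red a (Finset.mem_Icc.mpr ⟨by omega, ha12⟩) h3 b 
      (Finset.mem_Icc.mpr ⟨by omega, by omega⟩) h1 h2 h4
  rcases N.mt with ⟨h4, hsh, hd⟩ | ⟨h4, hsh, hd⟩
  · have hsh' : (P : ℂ) * k = 2 * sh := by exact_mod_cast hsh
    have hd' : 4 * (P : ℂ) * r - P ^ 2 * k ^ 2 = 4 * d := by exact_mod_cast hd
    have D : Dat P k r (sh + w) s := by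
      refine ⟨N.hP, N.hr, ?_, ?_, hs2, hcs, N.hΔ, N.sq1, N.sq3, hred⟩
      · have e1 : (sh : ℂ) + w = (P * k + 2 * w) / 2 := by rw [hsh']; ring
        rw [e1]
        linear_combination hw2 + (1 / 4 : ℂ) * hd'
      · rw [map_add, map_intCast, hcw, hsh']; ring
    refine final_aux D d m hm sh w rfl (by rw [hw]; simpa using hR0) ?_ ?_ hne
    · intro a b
      simp only [Qf, if_neg h4, map_add, map_mul, map_intCast, hcw]
      push_cast
      linear_combination (-(b : ℂ) ^ 2) * hw2
    · intro a b
      simp only [Vf, if_neg h4]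
      have : ((a : ℂ) + b * w) ^ 2 = ((a ^ 2 - d * b ^ 2 : ℝ) : ℂ) + (2 * a * b * R : ℝ) * Complex.I := by
        push_cast
        rw [hw] at hw2 ⊢
        linear_combination (b : ℂ) ^ 2 * hw2
      rw [this, Complex.add_re, Complex.re_ofReal_mul, Complex.ofReal_re]
      simp
  · have hsh' : (P : ℂ) * k = 2 * sh + 1 := by exact_mod_cast hsh
    have hd' : 4 * (P : ℂ) * r - P ^ 2 * k ^ 2 = d := by exact_mod_cast hd
    have D : Dat P k r (sh + (1 + w) / 2) s := by
      refine ⟨N.hP, N.hr, ?_, ?_, hs2, hcs, N.hΔ, N.sq1, N.sq3, hred⟩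
      · have e1 : (sh : ℂ) + (1 + w) / 2 = (P * k + w) / 2 := by rw [hsh']; ring
        rw [e1]
        linear_combination (1 / 4 : ℂ) * hw2 + (1 / 4 : ℂ) * hd'
      · simp only [map_add, map_intCast, hcw, hsh', map_div₀, map_one, Complex.conj_ofNat]; ring
    have hq : (((1 + d) / 4 : ℕ) : ℂ) = (1 + d) / 4 := by
      have : 4 ∣ 1 + d := by omega
      rw [Nat.cast_div this (by norm_num)]; push_cast; ring
    refine final_aux D d m hm sh ((1 + w) / 2) rfl (by rw [hw]; simpa using hR0) ?_ ?_ hne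
    · intro a b
      simp only [Qf, if_pos h4, map_add, map_mul, map_intCast, hcw, map_div₀, map_one,
        Complex.conj_ofNat]
      rw [Int.cast_add, Int.cast_mul, Int.cast_natCast, hq]
      push_cast
      linear_combination (-(b : ℂ) ^ 2 / 4) * hw2
    · intro a b
      simp only [Vf, if_pos h4]
      have : ((a : ℂ) + b * ((1 + w) / 2)) ^ 2 = 
          ((((2 * a + b) ^ 2 - d * b ^ 2) / 4 : ℝ) : ℂ) + ((2 * a + b) * b * R / 2: ℝ) * Complex.I := by
        push_cast
        rw [hw] at hw2 ⊢
        linear_combination (b : ℂ) ^ 2 / 4 * hw2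
      rw [this, Complex.add_re, Complex.re_ofReal_mul, Complex.ofReal_re]
      simp
end

lemma not_sq (n j : ℤ) (h1 : 0 ≤ j) (h2 : j ^ 2 < n) (h3 : n < (j + 1) ^ 2) : ¬ IsSquare n := by
  rintro ⟨x, rfl⟩
  have a1 : j < |x| := by
    by_contra h
    push Not at h
    nlinarith [abs_mul_abs_self x, abs_nonneg x]
  have a2 : |x| < j + 1 := by
    by_contra h
    push Not at h
    nlinarith [abs_mul_abs_self x, abs_nonneg x]
  omega

lemma mkNum (d P : ℕ) (k r sh j1 j3 : ℤ) (hP : P.Prime)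
    (h : 0 < d ∧ ¬ (P : ℤ) ∣ r ∧ 4 * (P : ℤ) < 4 * P * r - P ^ 2 * k ^ 2 ∧
      (0 ≤ j1 ∧ j1 ^ 2 < 4 * P * r - P ^ 2 * k ^ 2 ∧ 4 * P * r - P ^ 2 * k ^ 2 < (j1 + 1) ^ 2) ∧
      (0 ≤ j3 ∧ j3 ^ 2 < 3 * (4 * P * r - P ^ 2 * k ^ 2) ∧
        3 * (4 * P * r - P ^ 2 * k ^ 2) < (j3 + 1) ^ 2) ∧
      4 * P * r - P ^ 2 * k ^ 2 < 507 ∧ (0 ≤ P * k ∧ P * k ≤ 13) ∧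
      (∀ a ∈ Finset.Icc (1 : ℤ) 12, 3 * a ^ 2 ≤ 4 * P * r - P ^ 2 * k ^ 2 →
        ∀ b ∈ Finset.Icc (-13 : ℤ) 6, -a ≤ 2 * b + P * k →
        2 * b + P * k ≤ a → a ∣ b ^ 2 + P * k * b + P * r →
        a = 1 ∨ (a = P ∧ (P : ℤ) ∣ b) ∨ (a = r ∧ (r ∣ b ∨ r ∣ b + P * k))) ∧
      ((d % 4 ≠ 3 ∧ P * k = 2 * sh ∧ 4 * P * r - P ^ 2 * k ^ 2 = 4 * d) ∨
        (d % 4 = 3 ∧ P * k = 2 * sh + 1 ∧ 4 * P * r - P ^ 2 * k ^ 2 = d))) :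
    NumDat d P k r sh := by
  obtain ⟨h1, h2, h3, ⟨a1, a2, a3⟩, ⟨b1, b2, b3⟩, h6, h7, h8, h9⟩ := h
  exact ⟨h1, hP, h2, h3, not_sq _ j1 a1 a2 a3, not_sq _ j3 b1 b2 b3, h6, h7, h8, h9⟩

/-- For `d` in the list of squarefree values with `ℚ(√−d)` of class number 2
and any positive integer `m`, if the shell `S_d(m)` is nonempty then
`∑_{(a,b) ∈ S_d(m)} V_d(a,b) ≠ 0`; in particular the shell of norm `m` of the lattice `L_o`
attached to the principal ideal class of `ℚ(√−d)` is not a spherical 2-design. -/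
theorem stmt_1 (d : ℕ) (hd : d ∈ ({5, 6, 10, 13, 15, 22, 35, 37, 51, 58, 91, 115, 123, 187, 235, 267, 403, 427} : Finset ℕ))
    (m : ℕ) (hm : 0 < m) (hne : (shell d m).Nonempty) :
    (∑ᶠ p ∈ shell d m, Vf d p) ≠ 0 := by
  simp only [Finset.mem_insert, Finset.mem_singleton] at hd
  rcases hd with rfl | rfl | rfl | rfl | rfl | rfl | rfl | rfl | rfl | rfl | rfl | rfl | rfl | rfl | rfl | rfl | rfl | rfl
  · exact (mkNum 5 2 1 3 1 4 7 (by norm_num) (by decide +kernel)).final m hm hne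
  · exact (mkNum 6 2 0 3 0 4 8 (by norm_num) (by decide +kernel)).final m hm hne
  · exact (mkNum 10 2 0 5 0 6 10 (by norm_num) (by decide +kernel)).final m hm hne
  · exact (mkNum 13 2 1 7 1 7 12 (by norm_num) (by decide +kernel)).final m hm hne
  · exact (mkNum 15 3 1 2 1 3 6 (by norm_num) (by decide +kernel)).final m hm hne
  · exact (mkNum 22 2 0 11 0 9 16 (by norm_num) (by decide +kernel)).final m hm hne
  · exact (mkNum 35 5 1 3 2 5 10 (by norm_num) (by decide +kernel)).final m hm hne
  · exact (mkNum 37 2 1 19 1 12 21 (by norm_num) (by decide +kernel)).final m hm hne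
  · exact (mkNum 51 3 1 5 1 7 12 (by norm_num) (by decide +kernel)).final m hm hne
  · exact (mkNum 58 2 0 29 0 15 26 (by norm_num) (by decide +kernel)).final m hm hne
  · exact (mkNum 91 7 1 5 3 9 16 (by norm_num) (by decide +kernel)).final m hm hne
  · exact (mkNum 115 5 1 7 2 10 18 (by norm_num) (by decide +kernel)).final m hm hne
  · exact (mkNum 123 3 1 11 1 11 19 (by norm_num) (by decide +kernel)).final m hm hne
  · exact (mkNum 187 11 1 7 5 13 23 (by norm_num) (by decide +kernel)).final m hm hne
  · exact (mkNum 235 5 1 13 2 15 26 (by norm_num) (by decide +kernel)).final m hm hne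
  · exact (mkNum 267 3 1 23 1 16 28 (by norm_num) (by decide +kernel)).final m hm hne
  · exact (mkNum 403 13 1 11 6 20 34 (by norm_num) (by decide +kernel)).final m hm hne
  · exact (mkNum 427 7 1 17 3 20 35 (by norm_num) (by decide +kernel)).final m hm hne
end

section
/- Let d ∈ {5, 6, 10, 13, 15, 22, 35, 37, 51, 58, 91, 115, 123, 187, 235, 267, 403, 427} and let m be a positive integer. If the shell S^a_d(m) = {(x,y) ∈ ℤ × ℤ : f_d(x,y) = m} of the nonprincipal form is nonempty, then ∑_{(x,y) ∈ S^a_d(m)} V^a_d(x,y) ≠ 0. In particular, the shell of norm m of the lattice L_a attached to the nonprincipal ideal class of ℚ(√−d) is not a spherical 2-design. -/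
/-- The coefficients `(A, B, C)` of the reduced binary quadratic form
`f_d(x,y) = A·x² + B·x·y + C·y²` attached to the nonprincipal ideal class of `ℚ(√−d)`,
for each squarefree `d` with class number 2. -/
def npABC (d : ℕ) : ℤ × ℤ × ℤ :=
  if d = 5 then (2, 2, 3)
  else if d = 6 then (2, 0, 3)
  else if d = 10 then (2, 0, 5)
  else if d = 13 then (2, 2, 7)
  else if d = 15 then (2, 1, 2)
  else if d = 22 then (2, 0, 11)
  else if d = 35 then (3, 1, 3)
  else if d = 37 then (2, 2, 19)
  else if d = 51 then (3, 3, 5)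
  else if d = 58 then (2, 0, 29)
  else if d = 91 then (5, 3, 5)
  else if d = 115 then (5, 5, 7)
  else if d = 123 then (3, 3, 11)
  else if d = 187 then (7, 3, 7)
  else if d = 235 then (5, 5, 13)
  else if d = 267 then (3, 3, 23)
  else if d = 403 then (11, 9, 11)
  else (7, 7, 17)

/-- The nonprincipal form `f_d(x,y) = A·x² + B·x·y + C·y²`. -/
def fnp (d : ℕ) (p : ℤ × ℤ) : ℤ :=
  (npABC d).1 * p.1 ^ 2 + (npABC d).2.1 * p.1 * p.2 + (npABC d).2.2 * p.2 ^ 2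

/-- The value `V^a_d(x,y) = ((2Ax+By)² + (B²−4AC)·y²)/(4A)` of the harmonic polynomial
`x² − y²` at the point of the lattice `L_a` corresponding to `(x,y) ∈ ℤ²`. -/
def Vnp (d : ℕ) (p : ℤ × ℤ) : ℚ :=
  (((2 * (npABC d).1 * p.1 + (npABC d).2.1 * p.2) ^ 2
      + ((npABC d).2.1 ^ 2 - 4 * (npABC d).1 * (npABC d).2.2) * p.2 ^ 2 : ℤ) : ℚ)
    / (4 * ((npABC d).1 : ℚ))

/-- The shell of norm `m` of the lattice `L_a`:
`S^a_d(m) = {(x,y) ∈ ℤ × ℤ : f_d(x,y) = m}`. -/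
def shellNp (d m : ℕ) : Set (ℤ × ℤ) := {p | fnp d p = (m : ℤ)}

namespace QShell

open QuadraticAlgebra

variable {a b : ℤ}

theorem idvd {n : ℤ} {z : QuadraticAlgebra ℤ a b} :
    ((n : ℤ) : QuadraticAlgebra ℤ a b) ∣ z ↔ n ∣ z.re ∧ n ∣ z.im := by
  have := algebraMap_dvd_iff (R := ℤ) (a := a) (b := b) (r := n) (z := z)
  simpa using this

theorem ncast (z : QuadraticAlgebra ℤ a b) :
    ((norm z : ℤ) : QuadraticAlgebra ℤ a b) = z * star z := by
  have := algebraMap_norm_eq_mul_star (R := ℤ) (a := a) (b := b) z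
  simpa using this

theorem nint (n : ℤ) : norm ((n : ℤ) : QuadraticAlgebra ℤ a b) = n ^ 2 := by
  simp [norm_def, pow_two]

theorem icancel {n : ℤ} (hn : n ≠ 0) {x y : QuadraticAlgebra ℤ a b}
    (h : (n : QuadraticAlgebra ℤ a b) * x = n * y) : x = y := by
  have h1 := congrArg QuadraticAlgebra.re h
  have h2 := congrArg QuadraticAlgebra.im h
  simp [hn] at h1 h2
  exact QuadraticAlgebra.ext h1 h2

theorem pcancel {p n : ℤ} (hp : Prime p) {z : QuadraticAlgebra ℤ a b}
    (h : (p : QuadraticAlgebra ℤ a b) ∣ n * z) (hn : ¬ p ∣ n) :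
    (p : QuadraticAlgebra ℤ a b) ∣ z := by
  rw [idvd] at h ⊢
  simp at h
  exact ⟨(hp.dvd_or_dvd h.1).resolve_left hn, (hp.dvd_or_dvd h.2).resolve_left hn⟩

/-- trace -/
def tr (z : QuadraticAlgebra ℤ a b) : ℤ := 2 * z.re + b * z.im

theorem add_star_eq (z : QuadraticAlgebra ℤ a b) :
    z + star z = (tr z : ℤ) := by
  ext
  · simp [tr]; ring
  · simp

theorem tr_star (z : QuadraticAlgebra ℤ a b) : tr (star z) = tr z := by
  simp [tr]; ring

theorem star_dvd {n : ℤ} {z : QuadraticAlgebra ℤ a b}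
    (h : (n : QuadraticAlgebra ℤ a b) ∣ star z) : (n : QuadraticAlgebra ℤ a b) ∣ z := by
  obtain ⟨w, hw⟩ := h
  refine ⟨star w, ?_⟩
  have := congrArg star hw
  simpa [mul_comm] using this

/-- The element `γ` of norm `p²` not divisible by `p`. -/
structure Good (p : ℤ) (γ : QuadraticAlgebra ℤ a b) : Prop where
  pr : Prime p
  nm : norm γ = p ^ 2
  nd : ¬ (p : QuadraticAlgebra ℤ a b) ∣ γ
  nt : ¬ p ∣ tr γ

variable {p : ℤ} {γ : QuadraticAlgebra ℤ a b}

theorem Good.symm (h : Good p γ) : Good p (star γ) where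
  pr := h.pr
  nm := by simpa using h.nm
  nd := fun h' => h.nd (star_dvd h')
  nt := by rw [tr_star]; exact h.nt

theorem Good.mul_star (h : Good p γ) : γ * star γ = (p : QuadraticAlgebra ℤ a b) ^ 2 := by
  rw [← ncast, h.nm]; push_cast; rfl

theorem Good.ne (h : Good p γ) : p ≠ 0 := h.pr.ne_zero

theorem Good.sq (h : Good p γ) : γ * γ = (tr γ : ℤ) * γ - (p : QuadraticAlgebra ℤ a b) ^ 2 := by
  rw [← h.mul_star, ← add_star_eq]; ring

theorem dvd_im {z : QuadraticAlgebra ℤ a b} (hp : Prime p) (hN : p ∣ norm z)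
    (hi : p ∣ z.im) : (p : QuadraticAlgebra ℤ a b) ∣ z := by
  rw [idvd]
  refine ⟨?_, hi⟩
  obtain ⟨c, hc⟩ := hi
  rw [norm_def, hc] at hN
  have : p ∣ z.re * z.re := by
    obtain ⟨e, he⟩ := hN
    exact ⟨e - b * z.re * c + a * c * (p * c), by linear_combination he⟩
  exact (hp.dvd_or_dvd this).elim id id

theorem Good.nim (h : Good p γ) : ¬ p ∣ γ.im := fun hi =>
  h.nd (dvd_im h.pr (by rw [h.nm]; exact dvd_pow_self _ two_ne_zero) hi)

theorem Good.scal (h : Good p γ) (x : QuadraticAlgebra ℤ a b) :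
    ∃ c : ℤ, (p : QuadraticAlgebra ℤ a b) ∣ x * γ - c * γ := by
  have hc : IsCoprime p γ.im := (h.pr.irreducible.coprime_iff_not_dvd).2 h.nim
  obtain ⟨u, v, huv⟩ := hc
  -- x ≡ x.re + x.im * v * (γ - γ.re)
  refine ⟨x.re + x.im * v * (tr γ - γ.re), ?_⟩
  have hx : x = ((x.re - x.im * v * γ.re : ℤ) : QuadraticAlgebra ℤ a b) + (x.im * v : ℤ) * γ
      + (p : QuadraticAlgebra ℤ a b) * ⟨0, u * x.im⟩ := by
    ext
    · simp
    · simp; linear_combination (-x.im) * huv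
  have h2 := h.sq
  refine ⟨⟨0, u * x.im⟩ * γ - (x.im * v : ℤ) * p, ?_⟩
  nth_rewrite 1 [hx]
  push_cast
  linear_combination (x.im * v : QuadraticAlgebra ℤ a b) * h2

theorem Good.prime (h : Good p γ) {x y : QuadraticAlgebra ℤ a b}
    (hx : ¬ (p : QuadraticAlgebra ℤ a b) ∣ γ * x) (hy : ¬ (p : QuadraticAlgebra ℤ a b) ∣ γ * y) :
    ¬ (p : QuadraticAlgebra ℤ a b) ∣ γ * (x * y) := by
  obtain ⟨c, hc⟩ := h.scal x
  intro hd
  have h1 : (p : QuadraticAlgebra ℤ a b) ∣ c * (γ * y) := by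
    have : (c : QuadraticAlgebra ℤ a b) * (γ * y) = γ * (x * y) - (x * γ - c * γ) * y := by ring
    rw [this]
    exact dvd_sub hd (hc.mul_right _)
  by_cases hpc : p ∣ c
  · apply hx
    have : γ * x = (x * γ - c * γ) + c * γ := by ring
    rw [this]
    refine dvd_add hc (Dvd.dvd.mul_right ?_ _)
    exact_mod_cast (Int.cast_dvd_cast _ _ hpc)
  · exact hy (pcancel h.pr h1 hpc)

theorem Good.npow (h : Good p γ) (j : ℕ) : ¬ (p : QuadraticAlgebra ℤ a b) ∣ γ ^ j := by
  have key : ∀ j : ℕ, ¬ (p : QuadraticAlgebra ℤ a b) ∣ γ * γ ^ j := by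
    intro j
    induction j with
    | zero => simpa using h.nd
    | succ j ih =>
      rw [pow_succ]
      refine h.prime ih ?_
      intro hd
      rw [h.sq] at hd
      have : (p : QuadraticAlgebra ℤ a b) ∣ (tr γ : ℤ) * γ := by
        have := dvd_add hd (dvd_pow_self (p : QuadraticAlgebra ℤ a b) two_ne_zero)
        simpa using this
      exact h.nd (pcancel h.pr this h.nt)
  intro hd
  exact key j (hd.mul_left _)

theorem Good.bound (h : Good p γ) {α β : QuadraticAlgebra ℤ a b} {j l : ℕ} {n : ℤ}
    (hN : norm α = p ^ l * n) (hn : ¬ p ∣ n) (hb : (p : QuadraticAlgebra ℤ a b) ^ j * β = γ ^ j * α) :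
    j ≤ l := by
  by_contra hlt
  push Not at hlt
  obtain ⟨e, rfl⟩ := Nat.exists_eq_add_of_lt hlt
  have h1 : ((p ^ l : ℤ) : QuadraticAlgebra ℤ a b) * (p * (p ^ e * (β * star α)))
      = ((p ^ l : ℤ) : QuadraticAlgebra ℤ a b) * (n * γ ^ (l + e + 1)) := by
    have h2 := ncast α
    rw [hN] at h2
    push_cast at h2 ⊢
    linear_combination (star α) * hb - γ ^ (l + e + 1) * h2
  have h3 := icancel (pow_ne_zero _ h.ne) h1
  exact h.npow _ (pcancel h.pr ⟨_, h3.symm⟩ hn)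

theorem Good.exact_ (h : Good p γ) {α β : QuadraticAlgebra ℤ a b} {j l : ℕ} {n : ℤ}
    (hN : norm α = p ^ l * n) (hn : ¬ p ∣ n) (hb : (p : QuadraticAlgebra ℤ a b) ^ j * β = γ ^ j * α)
    (ha : ¬ (p : QuadraticAlgebra ℤ a b) ∣ star γ * α) (hβ : ¬ (p : QuadraticAlgebra ℤ a b) ∣ γ * β) :
    j = l := by
  refine le_antisymm (h.bound hN hn hb) ?_
  by_contra hlt
  push Not at hlt
  obtain ⟨e, rfl⟩ := Nat.exists_eq_add_of_lt hlt
  have ha' : ¬ (p : QuadraticAlgebra ℤ a b) ∣ γ * star α := by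
    intro hd
    apply ha
    apply star_dvd
    simpa [mul_comm] using hd
  apply h.prime hβ ha'
  have h1 : ((p ^ j : ℤ) : QuadraticAlgebra ℤ a b) * (β * star α)
      = ((p ^ j : ℤ) : QuadraticAlgebra ℤ a b) * (p * (γ ^ j * p ^ e * n)) := by
    have h2 := ncast α
    rw [hN] at h2
    push_cast at h2 ⊢
    linear_combination (star α) * hb - γ ^ j * h2
  have h3 := icancel (pow_ne_zero _ h.ne) h1
  rw [h3]
  exact ⟨γ * (γ ^ j * p ^ e * n), by ring⟩

theorem Good.exists_max (h : Good p γ) {α : QuadraticAlgebra ℤ a b} {l : ℕ} {n : ℤ}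
    (hN : norm α = p ^ l * n) (hn : ¬ p ∣ n) (S : Set (QuadraticAlgebra ℤ a b)) (hα : α ∈ S)
    (up : ∀ α ∈ S, ∀ β, (p : QuadraticAlgebra ℤ a b) * β = γ * α → β ∈ S) :
    ∃ (j : ℕ) (β : QuadraticAlgebra ℤ a b), β ∈ S ∧
      (p : QuadraticAlgebra ℤ a b) ^ j * β = γ ^ j * α ∧
      ¬ (p : QuadraticAlgebra ℤ a b) ∣ γ * β := by
  by_contra hcon
  push Not at hcon
  have : ∀ j : ℕ, ∃ β : QuadraticAlgebra ℤ a b, β ∈ S ∧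
      (p : QuadraticAlgebra ℤ a b) ^ j * β = γ ^ j * α := by
    intro j
    induction j with
    | zero => exact ⟨α, hα, by simp⟩
    | succ j ih =>
      obtain ⟨β, hS, hβ⟩ := ih
      obtain ⟨δ, hδ⟩ := hcon j β hS hβ
      exact ⟨δ, up β hS δ hδ.symm,
        by linear_combination γ * hβ - (p : QuadraticAlgebra ℤ a b) ^ j * hδ⟩
  obtain ⟨β, -, hβ⟩ := this (l + 1)
  have := h.bound hN hn hβ
  omega

/-- Bottom elements get moved to top elements by exactly `l` steps. -/
theorem Good.move (h : Good p γ) {α : QuadraticAlgebra ℤ a b} {l : ℕ} {n : ℤ}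
    (hN : norm α = p ^ l * n) (hn : ¬ p ∣ n) (ha : ¬ (p : QuadraticAlgebra ℤ a b) ∣ star γ * α)
    (S : Set (QuadraticAlgebra ℤ a b)) (hα : α ∈ S)
    (up : ∀ α ∈ S, ∀ β, (p : QuadraticAlgebra ℤ a b) * β = γ * α → β ∈ S) :
    ∃ β : QuadraticAlgebra ℤ a b, β ∈ S ∧
      (p : QuadraticAlgebra ℤ a b) ^ l * β = γ ^ l * α ∧
      ¬ (p : QuadraticAlgebra ℤ a b) ∣ γ * β := by
  obtain ⟨j, β, hS, hb, hβ⟩ := h.exists_max hN hn S hα up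
  obtain rfl := h.exact_ hN hn hb ha hβ
  exact ⟨β, hS, hb, hβ⟩

/-- exact division by an integer -/
def idiv (n : ℤ) (z : QuadraticAlgebra ℤ a b) : QuadraticAlgebra ℤ a b := ⟨z.re / n, z.im / n⟩

theorem idiv_eq {n : ℤ} (hn : n ≠ 0) {z w : QuadraticAlgebra ℤ a b}
    (h : (n : QuadraticAlgebra ℤ a b) * w = z) : idiv n z = w := by
  subst h
  ext <;> simp [idiv, hn]

theorem sum_transfer {n : ℤ} (hn : n ≠ 0) {g g' : QuadraticAlgebra ℤ a b}
    (hg : g * g' = (n : QuadraticAlgebra ℤ a b) ^ 2) (S T : Finset (QuadraticAlgebra ℤ a b))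
    (hS : ∀ α ∈ S, ∃ β ∈ T, (n : QuadraticAlgebra ℤ a b) * β = g * α)
    (hT : ∀ β ∈ T, ∃ α ∈ S, (n : QuadraticAlgebra ℤ a b) * α = g' * β) :
    (n : QuadraticAlgebra ℤ a b) ^ 2 * ∑ β ∈ T, β ^ 2 = g ^ 2 * ∑ α ∈ S, α ^ 2 := by
  rw [Finset.mul_sum, Finset.mul_sum]
  symm
  refine Finset.sum_nbij' (fun α => idiv n (g * α)) (fun β => idiv n (g' * β)) ?_ ?_ ?_ ?_ ?_
  · intro α hα
    obtain ⟨β, hβ, h⟩ := hS α hα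
    simpa [idiv_eq hn h] using hβ
  · intro β hβ
    obtain ⟨α, hα, h⟩ := hT β hβ
    simpa [idiv_eq hn h] using hα
  · intro α hα
    obtain ⟨β, hβ, h⟩ := hS α hα
    simp only [idiv_eq hn h]
    apply idiv_eq hn
    apply icancel hn
    linear_combination -g' * h - α * hg
  · intro β hβ
    obtain ⟨α, hα, h⟩ := hT β hβ
    simp only [idiv_eq hn h]
    apply idiv_eq hn
    apply icancel hn
    linear_combination -g * h - β * hg
  · intro α hα
    obtain ⟨β, hβ, h⟩ := hS α hα
    simp only [idiv_eq hn h]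
    linear_combination (-(n : QuadraticAlgebra ℤ a b) * β - g * α) * h

theorem norm_eq_zero' (hD : b ^ 2 + 4 * a < 0) {z : QuadraticAlgebra ℤ a b} (h : norm z = 0) :
    z = 0 := by
  rw [norm_def] at h
  have h1 : (2 * z.re + b * z.im) ^ 2 + (-(b ^ 2 + 4 * a)) * z.im ^ 2 = 0 := by
    linear_combination 4 * h
  have h2 : z.im = 0 := by
    by_contra hne
    have : 0 < z.im ^ 2 := by positivity
    nlinarith [sq_nonneg (2 * z.re + b * z.im)]
  rw [h2] at h1
  have h3 : z.re = 0 := by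
    simpa using h1
  exact QuadraticAlgebra.ext h3 h2

theorem mul_ne_zero' (hD : b ^ 2 + 4 * a < 0) {z w : QuadraticAlgebra ℤ a b} (hz : z ≠ 0)
    (hw : w ≠ 0) : z * w ≠ 0 := by
  intro h
  have : norm z * norm w = 0 := by rw [← map_mul, h]; simp
  rcases mul_eq_zero.1 this with h | h
  · exact hz (norm_eq_zero' hD h)
  · exact hw (norm_eq_zero' hD h)

open Classical in
theorem Good.step (hD : b ^ 2 + 4 * a < 0) (h : Good p γ) (X : Finset (QuadraticAlgebra ℤ a b))
    {l : ℕ} {n : ℤ} (hn : ¬ p ∣ n)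
    (hN : ∀ α ∈ X, norm α = p ^ l * n)
    (up : ∀ α ∈ X, ∀ β, (p : QuadraticAlgebra ℤ a b) * β = γ * α → β ∈ X)
    (down : ∀ α ∈ X, ∀ β, (p : QuadraticAlgebra ℤ a b) * β = star γ * α → β ∈ X) :
    (X.Nonempty → (X.filter (fun α => ¬ (p : QuadraticAlgebra ℤ a b) ∣ star γ * α)).Nonempty) ∧
    (∑ α ∈ X.filter (fun α => ¬ (p : QuadraticAlgebra ℤ a b) ∣ star γ * α), α ^ 2 ≠ 0 →
      ∑ α ∈ X, α ^ 2 ≠ 0) := by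
  constructor
  · rintro ⟨α, hα⟩
    obtain ⟨j, β, hS, -, hβ⟩ := h.symm.exists_max (hN α hα) hn (X : Set _) hα down
    exact ⟨β, Finset.mem_filter.2 ⟨hS, hβ⟩⟩
  · set B := X.filter (fun α => ¬ (p : QuadraticAlgebra ℤ a b) ∣ star γ * α) with hB
    set T := X.filter (fun α => ¬ (p : QuadraticAlgebra ℤ a b) ∣ γ * α) with hT
    have s1 := Finset.sum_filter_add_sum_filter_not X
      (fun α => (p : QuadraticAlgebra ℤ a b) ∣ star γ * α) (fun α => α ^ 2)
    have s2 := Finset.sum_filter_add_sum_filter_not X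
      (fun α => (p : QuadraticAlgebra ℤ a b) ∣ γ * α) (fun α => α ^ 2)
    rw [← hB] at s1
    rw [← hT] at s2
    have hms := h.mul_star
    have t1 := sum_transfer h.ne hms
      (X.filter (fun α => (p : QuadraticAlgebra ℤ a b) ∣ γ * α))
      (X.filter (fun α => (p : QuadraticAlgebra ℤ a b) ∣ star γ * α)) (by
        intro α hα
        rw [Finset.mem_filter] at hα
        obtain ⟨hα, β, hβ⟩ := hα
        refine ⟨β, Finset.mem_filter.2 ⟨up α hα β hβ.symm, α, ?_⟩, hβ.symm⟩
        apply icancel h.ne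
        linear_combination (-star γ) * hβ + α * hms) (by
        intro α hα
        rw [Finset.mem_filter] at hα
        obtain ⟨hα, β, hβ⟩ := hα
        refine ⟨β, Finset.mem_filter.2 ⟨down α hα β hβ.symm, α, ?_⟩, hβ.symm⟩
        apply icancel h.ne
        linear_combination (-γ) * hβ + α * hms)
    have t2 := sum_transfer (n := p ^ l) (g := γ ^ l) (g' := (star γ) ^ l)
      (pow_ne_zero _ h.ne) (by push_cast; rw [← mul_pow, hms]; ring) B T (by
        intro α hα
        rw [hB, Finset.mem_filter] at hα
        obtain ⟨β, h1, h2, h3⟩ := h.move (hN α hα.1) hn hα.2 (X : Set _) hα.1 up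
        exact ⟨β, Finset.mem_filter.2 ⟨h1, h3⟩, by push_cast; exact h2⟩) (by
        intro α hα
        rw [hT, Finset.mem_filter] at hα
        obtain ⟨β, h1, h2, h3⟩ := h.symm.move (hN α hα.1) hn (by simpa using hα.2)
          (X : Set _) hα.1 down
        exact ⟨β, Finset.mem_filter.2 ⟨h1, h3⟩, by push_cast; exact h2⟩)
    push_cast at t2
    intro hne hX0
    have hz : ((p : QuadraticAlgebra ℤ a b) ^ (2 * l + 2) - γ ^ (2 * l + 2)) * ∑ α ∈ B, α ^ 2 = 0 := by
      rw [hX0] at s1 s2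
      linear_combination (p : QuadraticAlgebra ℤ a b) ^ (2 * l + 2) * s1 -
        γ ^ 2 * p ^ (2 * l) * s2 - p ^ (2 * l) * t1 + γ ^ 2 * t2
    refine mul_ne_zero' hD ?_ hne hz
    intro h0
    apply h.npow (2 * l + 2)
    rw [← sub_eq_zero.1 h0]
    exact dvd_pow_self _ (by omega)

theorem norm_one_pm (hD : b ^ 2 + 4 * a < -4) {w : QuadraticAlgebra ℤ a b} (h : norm w = 1) :
    w = 1 ∨ w = -1 := by
  rw [norm_def] at h
  have h1 : (2 * w.re + b * w.im) ^ 2 + (-(b ^ 2 + 4 * a)) * w.im ^ 2 = 4 := by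
    linear_combination 4 * h
  have h2 : w.im = 0 := by
    by_contra hne
    have : 0 < w.im ^ 2 := by positivity
    nlinarith [sq_nonneg (2 * w.re + b * w.im)]
  rw [h2] at h
  have h3 : w.re = 1 ∨ w.re = -1 := by
    apply mul_self_eq_one_iff.1; linear_combination h
  rcases h3 with h3 | h3
  · left; ext <;> simp [h2, h3]
  · right; ext <;> simp [h2, h3]

theorem pow_dvd_of_inert {p : ℤ} (hp : Prime p)
    (h : ∀ x : QuadraticAlgebra ℤ a b, p ^ 2 ∣ norm x → (p : QuadraticAlgebra ℤ a b) ∣ x)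
    (k : ℕ) : ∀ x : QuadraticAlgebra ℤ a b, p ^ (2 * k) ∣ norm x →
      ((p ^ k : ℤ) : QuadraticAlgebra ℤ a b) ∣ x := by
  induction k with
  | zero => intro x _; simp
  | succ k ih =>
    intro x hx
    obtain ⟨y, rfl⟩ := h x ((pow_dvd_pow p (by omega)).trans hx)
    have : p ^ (2 * k) ∣ norm y := by
      rw [map_mul, nint, show 2 * (k + 1) = 2 + 2 * k by ring, pow_add] at hx
      exact (mul_dvd_mul_iff_left (pow_ne_zero 2 hp.ne_zero)).1 hx
    obtain ⟨z, hz⟩ := ih y this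
    refine ⟨z, ?_⟩
    rw [hz]; push_cast; ring

/-- coprime powers -/
theorem Good.cop (h : Good p γ) (k : ℕ) {x : QuadraticAlgebra ℤ a b}
    (h1 : ((p ^ k : ℤ) : QuadraticAlgebra ℤ a b) ∣ γ ^ k * x)
    (h2 : ((p ^ k : ℤ) : QuadraticAlgebra ℤ a b) ∣ (star γ) ^ k * x) :
    ((p ^ k : ℤ) : QuadraticAlgebra ℤ a b) ∣ x := by
  have h3 : ((p ^ k : ℤ) : QuadraticAlgebra ℤ a b) ∣ ((tr γ ^ (k + k) : ℤ)) * x := by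
    push_cast
    push_cast at h1 h2
    rw [← add_star_eq, add_pow, Finset.sum_mul]
    refine Finset.dvd_sum fun i hi => ?_
    rcases le_total k i with hk | hk
    · obtain ⟨e, rfl⟩ := Nat.exists_eq_add_of_le hk
      refine h1.trans ⟨γ ^ e * star γ ^ (k + k - (k + e)) * ((k + k).choose (k + e) : ℕ), ?_⟩
      rw [pow_add]; ring
    · obtain ⟨e, he⟩ : ∃ e, k + k - i = k + e := ⟨k - i, by omega⟩
      rw [he]
      refine h2.trans ⟨γ ^ i * star γ ^ e * ((k + k).choose i : ℕ), ?_⟩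
      rw [pow_add]; ring
  have hc : IsCoprime (p ^ k) (tr γ ^ (k + k)) :=
    ((h.pr.irreducible.coprime_iff_not_dvd).2 h.nt).pow
  rw [idvd] at h3 ⊢
  simp only [re_mul, im_mul, re_intCast, im_intCast, mul_zero, zero_mul, add_zero] at h3
  constructor
  · exact hc.dvd_of_dvd_mul_left (by simpa using h3.1)
  · exact hc.dvd_of_dvd_mul_left (by simpa using h3.2)

open Classical in
theorem shell_sum_ne (hD : b ^ 2 + 4 * a < -4) (M : ℕ) (hM : 0 < M)
    (hgood : ∀ p : ℕ, p.Prime →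
      (∀ x : QuadraticAlgebra ℤ a b, (p : ℤ) ^ 2 ∣ norm x →
        ((p : ℤ) : QuadraticAlgebra ℤ a b) ∣ x) ∨
      ∃ γ : QuadraticAlgebra ℤ a b, Good (p : ℤ) γ)
    (X : Finset (QuadraticAlgebra ℤ a b)) (hX : ∀ α, α ∈ X ↔ norm α = M) (hne : X.Nonempty) :
    ∑ α ∈ X, α ^ 2 ≠ 0 := by
  have hD0 : b ^ 2 + 4 * a < 0 := by linarith
  have hsk : ∀ p : ℕ, ∃ γ : QuadraticAlgebra ℤ a b,
      (∃ γ' : QuadraticAlgebra ℤ a b, Good (p : ℤ) γ') → Good (p : ℤ) γ := by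
    intro p
    by_cases h : ∃ γ' : QuadraticAlgebra ℤ a b, Good (p : ℤ) γ'
    · obtain ⟨γ, hγ⟩ := h
      exact ⟨γ, fun _ => hγ⟩
    · exact ⟨0, fun h' => absurd h' h⟩
  choose g hg using hsk
  have hval : ∀ p : ℕ, p.Prime → ∃ (l : ℕ) (n : ℤ), (M : ℤ) = (p : ℤ) ^ l * n ∧ ¬ (p : ℤ) ∣ n := by
    intro p hp
    obtain ⟨l, n, hn, h⟩ := Nat.exists_eq_pow_mul_and_not_dvd hM.ne' p hp.ne_one
    exact ⟨l, n, by rw [h]; push_cast; rfl, by exact_mod_cast hn⟩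
  have main : ∀ Q : Finset ℕ, (∀ p ∈ Q, p.Prime ∧ Good (p : ℤ) (g p)) →
      (X.filter (fun α => ∀ p ∈ Q, ¬ ((p : ℤ) : QuadraticAlgebra ℤ a b) ∣ star (g p) * α)).Nonempty ∧
      (∑ α ∈ X.filter (fun α => ∀ p ∈ Q, ¬ ((p : ℤ) : QuadraticAlgebra ℤ a b) ∣ star (g p) * α),
        α ^ 2 ≠ 0 → ∑ α ∈ X, α ^ 2 ≠ 0) := by
    intro Q
    induction Q using Finset.induction_on with
    | empty => intro _; simpa using hne
    | insert p Q hpQ ih =>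
      intro hQ
      obtain ⟨ih1, ih2⟩ := ih (fun r hr => hQ r (Finset.mem_insert_of_mem hr))
      obtain ⟨hp, hgp⟩ := hQ p (Finset.mem_insert_self _ _)
      obtain ⟨l, n, hl, hn⟩ := hval p hp
      have closed : ∀ γ : QuadraticAlgebra ℤ a b, Good (p : ℤ) γ →
          ∀ α ∈ X.filter (fun α => ∀ p ∈ Q, ¬ ((p : ℤ) : QuadraticAlgebra ℤ a b) ∣ star (g p) * α),
          ∀ β, ((p : ℤ) : QuadraticAlgebra ℤ a b) * β = γ * α →
          β ∈ X.filter (fun α => ∀ p ∈ Q, ¬ ((p : ℤ) : QuadraticAlgebra ℤ a b) ∣ star (g p) * α) := by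
        intro γ hγ α hα β hβ
        rw [Finset.mem_filter, hX] at hα ⊢
        constructor
        · have := congrArg QuadraticAlgebra.norm hβ
          rw [map_mul, map_mul, nint, hγ.nm] at this
          rw [mul_left_cancel₀ (pow_ne_zero 2 hγ.ne) this, hα.1]
        · intro r hr hd
          apply hα.2 r hr
          have hrg := (hQ r (Finset.mem_insert_of_mem hr))
          refine pcancel (n := (p : ℤ) ^ 2) hrg.2.pr ?_ ?_
          · have : (((p : ℤ) ^ 2 : ℤ) : QuadraticAlgebra ℤ a b) * (star (g r) * α) =
                (star (g r) * β) * ((p : ℤ) * star γ) := by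
              push_cast
              have h2 := hγ.mul_star
              push_cast at h2 hβ
              linear_combination (-star (g r) * α) * h2 - star (g r) * star γ * hβ
            rw [this]
            exact hd.mul_right _
          · intro hdd
            have h1 : (r : ℤ) ∣ p := hrg.2.pr.dvd_of_dvd_pow hdd
            have h2 : r = p := (Nat.prime_dvd_prime_iff_eq hrg.1 hp).1 (by exact_mod_cast h1)
            exact hpQ (h2 ▸ hr)
      have st := hgp.step hD0 _ hn (l := l) (fun α hα => by
        rw [Finset.mem_filter, hX] at hα
        rw [hα.1, hl]) (closed _ hgp) (closed _ hgp.symm)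
      have heq : X.filter (fun α => ∀ r ∈ insert p Q,
          ¬ ((r : ℤ) : QuadraticAlgebra ℤ a b) ∣ star (g r) * α) =
          (X.filter (fun α => ∀ r ∈ Q, ¬ ((r : ℤ) : QuadraticAlgebra ℤ a b) ∣ star (g r) * α)).filter
          (fun α => ¬ ((p : ℤ) : QuadraticAlgebra ℤ a b) ∣ star (g p) * α) := by
        ext α
        simp only [Finset.mem_filter, Finset.forall_mem_insert]
        tauto
      rw [heq]
      exact ⟨st.1 ih1, fun h => ih2 (st.2 h)⟩
  set Q := M.primeFactors.filter (fun p : ℕ => Good (p : ℤ) (g p)) with hQ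
  obtain ⟨h1, h2⟩ := main Q (by
    intro p hp
    rw [hQ, Finset.mem_filter] at hp
    exact ⟨Nat.prime_of_mem_primeFactors hp.1, hp.2⟩)
  apply h2
  set Y := X.filter (fun α => ∀ p : ℕ, p ∈ Q → ¬ ((p : ℤ) : QuadraticAlgebra ℤ a b) ∣ star (g p) * α) with hY
  obtain ⟨α, hα⟩ := h1
  have hMz : (M : ℤ) ≠ 0 := by exact_mod_cast hM.ne'
  have uniq : ∀ β ∈ Y, β = α ∨ β = -α := by
    intro β hβ
    rw [hY, Finset.mem_filter, hX] at hα hβ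
    have hpp : ∀ p k : ℕ, p.Prime → p ^ k ∣ M →
        ((((p : ℤ)) ^ k : ℤ) : QuadraticAlgebra ℤ a b) ∣ β * star α := by
      intro p k hp hk
      by_cases hG : Good (p : ℤ) (g p)
      · obtain ⟨l, n, hl, hn⟩ := hval p hp
        rcases Nat.eq_zero_or_pos k with rfl | hk0
        · simp
        have hpQ : p ∈ Q := by
          rw [hQ, Finset.mem_filter]
          exact ⟨Nat.mem_primeFactors.2 ⟨hp, (dvd_pow_self p hk0.ne').trans hk, hM.ne'⟩, hG⟩
        have hkl : ((p : ℤ) ^ k) ∣ (p : ℤ) ^ l := by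
          have h3 : ((p : ℤ) ^ k) ∣ (p : ℤ) ^ l * n := by
            rw [← hl]; exact_mod_cast hk
          have hc : IsCoprime ((p : ℤ) ^ k) n :=
            ((hG.pr.irreducible.coprime_iff_not_dvd).2 hn).pow_left
          exact hc.dvd_of_dvd_mul_right h3
        refine (Int.cast_dvd_cast _ _ hkl).trans ?_
        obtain ⟨δ, -, h3, -⟩ := hG.move (by rw [hα.1, hl]) hn (hα.2 p hpQ) Set.univ trivial
          (fun _ _ _ _ => trivial)
        obtain ⟨ε, -, h4, -⟩ := hG.move (by rw [hβ.1, hl]) hn (hβ.2 p hpQ) Set.univ trivial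
          (fun _ _ _ _ => trivial)
        refine hG.cop l ⟨ε * star α, ?_⟩ ⟨star δ * β, ?_⟩
        · push_cast at h4 ⊢
          linear_combination (-star α) * h4
        · have h5 := congrArg star h3
          simp only [star_mul, star_pow, star_intCast] at h5
          push_cast at h5 ⊢
          linear_combination (-β) * h5
      · have hin := (hgood p hp).resolve_right (fun h => hG (hg p h))
        refine pow_dvd_of_inert (Nat.prime_iff_prime_int.1 hp) hin k _ ?_
        rw [map_mul, QuadraticAlgebra.norm_star, hα.1, hβ.1, two_mul, pow_add]
        have : ((p : ℤ) ^ k) ∣ M := by exact_mod_cast hk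
        exact mul_dvd_mul this this
    have hdv : ((M : ℤ) : QuadraticAlgebra ℤ a b) ∣ β * star α := by
      rw [idvd]
      constructor
      · rw [Int.natCast_dvd, Nat.dvd_iff_prime_pow_dvd_dvd]
        intro p k hp hk
        have := (idvd.1 (hpp p k hp hk)).1
        rwa [← Nat.cast_pow, Int.natCast_dvd] at this
      · rw [Int.natCast_dvd, Nat.dvd_iff_prime_pow_dvd_dvd]
        intro p k hp hk
        have := (idvd.1 (hpp p k hp hk)).2
        rwa [← Nat.cast_pow, Int.natCast_dvd] at this
    obtain ⟨w, hw⟩ := hdv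
    have hw1 : norm w = 1 := by
      have := congrArg QuadraticAlgebra.norm hw
      rw [map_mul, map_mul, QuadraticAlgebra.norm_star, hα.1, hβ.1, nint] at this
      have h6 : (M : ℤ) ^ 2 * norm w = (M : ℤ) ^ 2 * 1 := by rw [← this]; ring
      exact mul_left_cancel₀ (pow_ne_zero 2 hMz) h6
    have hnc := ncast α
    rw [hα.1] at hnc
    rcases norm_one_pm hD hw1 with rfl | rfl
    · left
      apply icancel hMz
      linear_combination α * hw + β * hnc
    · right
      apply icancel hMz
      linear_combination α * hw + β * hnc
  have hα0 : α ≠ 0 := by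
    rintro rfl
    rw [hY, Finset.mem_filter, hX] at hα
    simp at hα
    omega
  have hαneg : α ≠ -α := by
    intro h
    apply hα0
    apply icancel (n := 2) two_ne_zero
    push_cast
    linear_combination h
  have hYeq : Y = {α, -α} := by
    ext β
    simp only [Finset.mem_insert, Finset.mem_singleton]
    refine ⟨uniq β, ?_⟩
    rintro (rfl | rfl)
    · exact hα
    · rw [hY, Finset.mem_filter, hX] at hα ⊢
      simpa using hα
  rw [hYeq, Finset.sum_pair hαneg]
  intro h0
  have : ((2 : ℤ) : QuadraticAlgebra ℤ a b) * (α * α) = (2 : ℤ) * 0 := by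
    push_cast; linear_combination h0
  exact mul_ne_zero' hD0 hα0 hα0 (icancel two_ne_zero this)

/-- The numerical hypotheses on the data. -/
structure Dat (a b q k : ℤ) : Prop where
  neg : b ^ 2 + 4 * a < -4
  hb : b = 0 ∨ b = 1
  h4 : b = 0 → a % 4 = 2 ∨ a % 4 = 3
  hsq : ∀ p : ℤ, Prime p → ¬ p ∣ 2 → ¬ p ^ 2 ∣ b ^ 2 + 4 * a
  hq : Prime q
  h1 : q ∣ b + 2 * k
  h2 : q ∣ a + k ^ 2
  hred : ∀ A B C : ℤ, 0 < A → |B| ≤ A → A ≤ C → B ^ 2 - 4 * A * C = b ^ 2 + 4 * a →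
    ∃ X Y : ℤ, A * X ^ 2 + B * X * Y + C * Y ^ 2 = 1 ∨ A * X ^ 2 + B * X * Y + C * Y ^ 2 = q

theorem four_norm_s2 (x : QuadraticAlgebra ℤ a b) :
    tr x ^ 2 - 4 * norm x = (b ^ 2 + 4 * a) * x.im ^ 2 := by
  rw [norm_def, tr]; ring

theorem dvd_D {p : ℤ} (hp : Prime p) {x : QuadraticAlgebra ℤ a b}
    (hx : ¬ (p : QuadraticAlgebra ℤ a b) ∣ x) (hN : p ∣ norm x) (ht : p ∣ tr x) :
    p ∣ b ^ 2 + 4 * a := by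
  have h : p ∣ (b ^ 2 + 4 * a) * x.im ^ 2 := by
    rw [← four_norm_s2]
    exact dvd_sub (dvd_pow ht two_ne_zero) (hN.mul_left _)
  rcases hp.dvd_or_dvd h with h | h
  · exact h
  · exact absurd (dvd_im hp hN (hp.dvd_of_dvd_pow h)) hx

theorem z4 : ∀ r i c : ZMod 4, (c = 2 ∨ c = 3) → r * r - c * i * i = 0 → 2 * r = 0 ∧ 2 * i = 0 := by
  decide

variable {q k : ℤ}

theorem Dat.ram (hd : Dat a b q k) {p : ℤ} (hp : Prime p) (hpD : p ∣ b ^ 2 + 4 * a)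
    (x : QuadraticAlgebra ℤ a b) (hx : p ^ 2 ∣ norm x) : (p : QuadraticAlgebra ℤ a b) ∣ x := by
  by_cases h2 : p ∣ 2
  · have hass : Associated p 2 := hp.associated_of_dvd Int.prime_two h2
    have h2p : (2 : ℤ) ∣ p := hass.dvd'
    have hb0 : b = 0 := by
      rcases hd.hb with h | h
      · exact h
      · have := h2p.trans hpD
        rw [h] at this
        omega
    have ha := hd.h4 hb0
    have hx4 : (4 : ℤ) ∣ norm x := (pow_dvd_pow_of_dvd h2p 2).trans hx
    rw [norm_def] at hx4
    have e1 : (((x.re * x.re - a * x.im * x.im : ℤ)) : ZMod 4) = 0 := by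
      rw [ZMod.intCast_zmod_eq_zero_iff_dvd]
      obtain ⟨e, he⟩ := hx4
      exact ⟨e, by push_cast; linear_combination he - x.re * x.im * hb0⟩
    have ea : ((a : ZMod 4) = 2 ∨ (a : ZMod 4) = 3) := by
      rcases ha with h | h
      · left
        have := (ZMod.intCast_eq_intCast_iff a 2 4).2 (by rw [Int.ModEq]; simpa using h)
        simpa using this
      · right
        have := (ZMod.intCast_eq_intCast_iff a 3 4).2 (by rw [Int.ModEq]; simpa using h)
        simpa using this
    push_cast at e1
    obtain ⟨f1, f2⟩ := z4 _ _ _ ea e1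
    have g1 : ((2 * x.re : ℤ) : ZMod 4) = 0 := by push_cast; exact f1
    have g2 : ((2 * x.im : ℤ) : ZMod 4) = 0 := by push_cast; exact f2
    rw [ZMod.intCast_zmod_eq_zero_iff_dvd] at g1 g2
    rw [idvd]
    push_cast at g1 g2
    exact ⟨h2.trans (by omega), h2.trans (by omega)⟩
  · have hpN : p ∣ norm x := (dvd_pow_self p two_ne_zero).trans hx
    have ht : p ∣ tr x := by
      apply hp.dvd_of_dvd_pow (n := 2)
      have := four_norm_s2 x
      rw [sub_eq_iff_eq_add.1 this]
      exact dvd_add (hpD.mul_right _) (hpN.mul_left _)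
    have h3 : p ^ 2 ∣ (b ^ 2 + 4 * a) * x.im ^ 2 := by
      rw [← four_norm_s2]
      exact dvd_sub (pow_dvd_pow_of_dvd ht 2) (hx.mul_left _)
    apply dvd_im hp hpN
    by_contra hi
    have hc : IsCoprime (p ^ 2) (x.im ^ 2) :=
      ((hp.irreducible.coprime_iff_not_dvd).2 hi).pow
    exact hd.hsq p hp h2 (hc.dvd_of_dvd_mul_right h3)

theorem Dat.reduce (hd : Dat a b q k) (n : ℕ) : ∀ A B C : ℤ, A.toNat = n → 0 < A →
    B ^ 2 - 4 * A * C = b ^ 2 + 4 * a →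
    ∃ X Y : ℤ, A * X ^ 2 + B * X * Y + C * Y ^ 2 = 1 ∨ A * X ^ 2 + B * X * Y + C * Y ^ 2 = q := by
  induction n using Nat.strong_induction_on with
  | _ n ih =>
    intro A B C hn hA hD
    set t : ℤ := -((B + A) / (2 * A)) with ht
    set B' : ℤ := B + 2 * A * t with hB'
    set C' : ℤ := A * t ^ 2 + B * t + C with hC'
    have hBB : |B'| ≤ A := by
      have e := Int.emod_add_mul_ediv (B + A) (2 * A)
      have e1 := Int.emod_nonneg (B + A) (show 2 * A ≠ 0 by omega)
      have e2 := Int.emod_lt_of_pos (B + A) (show 0 < 2 * A by omega)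
      have : B' = (B + A) % (2 * A) - A := by rw [hB', ht]; linarith
      rw [abs_le]
      constructor <;> linarith
    have hD' : B' ^ 2 - 4 * A * C' = b ^ 2 + 4 * a := by rw [← hD, hB', hC']; ring
    by_cases hAC : A ≤ C'
    · obtain ⟨X, Y, h⟩ := hd.hred A B' C' hA hBB hAC hD'
      refine ⟨X + t * Y, Y, ?_⟩
      have : A * (X + t * Y) ^ 2 + B * (X + t * Y) * Y + C * Y ^ 2 =
        A * X ^ 2 + B' * X * Y + C' * Y ^ 2 := by rw [hB', hC']; ring
      rwa [this]
    · have hC0 : 0 < C' := by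
        have := hd.neg
        have h4 : 0 < A * C' := by nlinarith [sq_nonneg B']
        exact pos_of_mul_pos_right h4 hA.le
      obtain ⟨X, Y, h⟩ := ih C'.toNat (by omega) C' B' A rfl hC0 (by rw [← hD']; ring)
      refine ⟨Y + t * X, X, ?_⟩
      have : A * (Y + t * X) ^ 2 + B * (Y + t * X) * X + C * X ^ 2 =
        C' * X ^ 2 + B' * X * Y + A * Y ^ 2 := by rw [hB', hC']; ring
      rwa [this]

theorem mk_good {p Q : ℤ} (hp : Prime p) (hpD : ¬ p ∣ b ^ 2 + 4 * a) (hQ : Q ∣ b ^ 2 + 4 * a)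
    (hQ0 : Q ≠ 0)
    {z : QuadraticAlgebra ℤ a b} (hz : norm z = p * Q) (hzz : (Q : QuadraticAlgebra ℤ a b) ∣ z * z) :
    ∃ γ : QuadraticAlgebra ℤ a b, Good p γ := by
  obtain ⟨γ, hγ⟩ := hzz
  have hpz : ¬ (p : QuadraticAlgebra ℤ a b) ∣ z := by
    rintro ⟨w, rfl⟩
    rw [map_mul, nint] at hz
    have : Q = p * norm w := by
      apply mul_left_cancel₀ hp.ne_zero
      rw [← hz]; ring
    exact hpD ((Dvd.intro _ this.symm).trans hQ)
  have hNg : norm γ = p ^ 2 := by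
    have := congrArg QuadraticAlgebra.norm hγ
    rw [map_mul, map_mul, nint, hz] at this
    apply mul_left_cancel₀ (pow_ne_zero 2 hQ0)
    rw [← this]; ring
  have hnd : ¬ (p : QuadraticAlgebra ℤ a b) ∣ γ := by
    intro hd
    have h1 : (p : QuadraticAlgebra ℤ a b) ∣ (tr z : ℤ) * z := by
      have : ((tr z : ℤ) : QuadraticAlgebra ℤ a b) * z = Q * γ + p * Q := by
        have h2 := ncast z
        rw [hz] at h2
        push_cast at h2
        rw [← hγ, ← add_star_eq, h2]; ring
      rw [this]
      exact dvd_add (hd.mul_left _) (dvd_mul_right _ _)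
    by_cases ht : p ∣ tr z
    · exact hpD (dvd_D hp hpz (by rw [hz]; exact dvd_mul_right _ _) ht)
    · exact hpz (pcancel hp h1 ht)
  exact ⟨γ, hp, hNg, hnd, fun ht => hpD (dvd_D hp hnd (by rw [hNg]; exact dvd_pow_self _ two_ne_zero) ht)⟩

theorem Dat.dvd_sub (hd : Dat a b q k) {z : QuadraticAlgebra ℤ a b} (hz : q ∣ norm z) :
    q ∣ z.re - k * z.im := by
  apply hd.hq.dvd_of_dvd_pow (n := 2)
  have : (z.re - k * z.im) ^ 2 = norm z - (b + 2 * k) * (z.re * z.im) + (a + k ^ 2) * z.im ^ 2 := by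
    rw [norm_def]; ring
  rw [this]
  exact dvd_add (_root_.dvd_sub hz (hd.h1.mul_right _)) (hd.h2.mul_right _)

theorem Dat.good (hd : Dat a b q k) (p : ℕ) (hp' : p.Prime) :
    (∀ x : QuadraticAlgebra ℤ a b, (p : ℤ) ^ 2 ∣ norm x →
        ((p : ℤ) : QuadraticAlgebra ℤ a b) ∣ x) ∨
      ∃ γ : QuadraticAlgebra ℤ a b, Good (p : ℤ) γ := by
  have hp : Prime (p : ℤ) := Nat.prime_iff_prime_int.1 hp'
  have hp0 : (0 : ℤ) < p := by exact_mod_cast hp'.pos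
  generalize (p : ℤ) = p at *
  by_contra hcon
  push Not at hcon
  obtain ⟨⟨x, hx, hpx⟩, hno⟩ := hcon
  have hpD : ¬ p ∣ b ^ 2 + 4 * a := fun h => hpx (hd.ram hp h x hx)
  have hqD : q ∣ b ^ 2 + 4 * a := by
    have : b ^ 2 + 4 * a = (b + 2 * k) * (b - 2 * k) + 4 * (a + k ^ 2) := by ring
    rw [this]
    exact dvd_add (hd.h1.mul_right _) (hd.h2.mul_left _)
  have hpim : ¬ p ∣ x.im := fun h => hpx (dvd_im hp ((dvd_pow_self p two_ne_zero).trans hx) h)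
  have hc : IsCoprime (p ^ 2) x.im := ((hp.irreducible.coprime_iff_not_dvd).2 hpim).pow_left
  obtain ⟨u, r, hur⟩ := hc
  obtain ⟨e, he⟩ := hx
  rw [norm_def] at he
  set s := r * x.re with hs
  obtain ⟨c, hcc⟩ : p ^ 2 ∣ s ^ 2 + b * s - a := by
    refine ⟨r ^ 2 * e + b * s * u - a * u * (1 + r * x.im), ?_⟩
    have h1 : r * x.im = 1 - u * p ^ 2 := by linarith
    rw [hs]
    linear_combination r ^ 2 * he + (a * (r * x.im + 1) - b * (r * x.re)) * hur
  obtain ⟨X, Y, h⟩ := hd.reduce _ p (2 * s + b) (p * c) rfl hp0 (by linear_combination 4 * hcc)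
  have hN : norm (⟨p * X + s * Y, Y⟩ : QuadraticAlgebra ℤ a b) =
      p * (p * X ^ 2 + (2 * s + b) * X * Y + p * c * Y ^ 2) := by
    rw [norm_def]
    linear_combination Y ^ 2 * hcc
  rcases h with h | h
  · rw [h] at hN
    obtain ⟨γ, hγ⟩ := mk_good hp hpD (one_dvd _) one_ne_zero hN (by simp)
    exact hno γ hγ
  · rw [h] at hN
    have hdv := hd.dvd_sub (z := (⟨p * X + s * Y, Y⟩ : QuadraticAlgebra ℤ a b))
      (by rw [hN]; exact dvd_mul_left _ _)
    generalize (⟨p * X + s * Y, Y⟩ : QuadraticAlgebra ℤ a b) = z at hN hdv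
    obtain ⟨γ, hγ⟩ := mk_good hp hpD hqD hd.hq.ne_zero hN (by
      rw [idvd]
      constructor
      · have : (z * z).re = (z.re - k * z.im) * (z.re + k * z.im) + (a + k ^ 2) * z.im ^ 2 := by
          simp; ring
        rw [this]
        exact dvd_add (hdv.mul_right _) (hd.h2.mul_right _)
      · have : (z * z).im = (z.re - k * z.im) * (2 * z.im) + (b + 2 * k) * z.im ^ 2 := by
          simp; ring
        rw [this]
        exact dvd_add (hdv.mul_right _) (hd.h1.mul_right _))
    exact hno γ hγ

theorem mk_dat (neg : b ^ 2 + 4 * a < -4) (lb : -427 ≤ b ^ 2 + 4 * a) (hb : b = 0 ∨ b = 1)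
    (h4 : b = 0 → a % 4 = 2 ∨ a % 4 = 3)
    (hsq : ∀ n ∈ Finset.Icc 3 20, ¬ ((n : ℤ) ^ 2 ∣ b ^ 2 + 4 * a))
    (hq : Prime q) (h1 : q ∣ b + 2 * k) (h2 : q ∣ a + k ^ 2)
    (hchk : ∀ A ∈ Finset.Icc (1 : ℤ) 11, ∀ B ∈ Finset.Icc (-11 : ℤ) 11, |B| ≤ A →
      (4 * A) ∣ (B ^ 2 - (b ^ 2 + 4 * a)) → A ≤ (B ^ 2 - (b ^ 2 + 4 * a)) / (4 * A) →
      A = 1 ∨ A = q ∨ (B ^ 2 - (b ^ 2 + 4 * a)) / (4 * A) = q ∨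
      A + B + (B ^ 2 - (b ^ 2 + 4 * a)) / (4 * A) = q ∨
      A - B + (B ^ 2 - (b ^ 2 + 4 * a)) / (4 * A) = q) : Dat a b q k where
  neg := neg
  hb := hb
  h4 := h4
  hsq := by
    intro p hp hp2 hdv
    generalize b ^ 2 + 4 * a = D at *
    rw [← Int.natAbs_dvd, Int.natAbs_pow] at hdv
    push_cast at hdv
    refine hsq p.natAbs ?_ (by push_cast; exact hdv)
    have hle := Int.le_of_dvd (by omega : 0 < -D) ((dvd_neg).2 hdv)
    have e1 : p.natAbs ≠ 0 := by simpa using hp.ne_zero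
    have e2 : p.natAbs ≠ 1 := fun h => hp.not_isUnit (Int.isUnit_iff_natAbs_eq.2 h)
    have e3 : p.natAbs ≠ 2 := by
      intro h
      apply hp2
      rw [← Int.natAbs_dvd, h]; norm_num
    rw [Finset.mem_Icc]
    constructor
    · omega
    · by_contra hgt
      push Not at hgt
      have : (21 : ℤ) ≤ |p| := by rw [Int.abs_eq_natAbs]; omega
      nlinarith
  hq := hq
  h1 := h1
  h2 := h2
  hred := by
    intro A B C hA hB hAC hD
    have hBA := abs_le.1 hB
    have hA11 : A ≤ 11 := by
      by_contra hgt
      push Not at hgt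
      nlinarith [mul_le_mul_of_nonneg_left hAC hA.le, sq_abs B, abs_nonneg B]
    have hC : (B ^ 2 - (b ^ 2 + 4 * a)) / (4 * A) = C := by
      apply Int.ediv_eq_of_eq_mul_right (by omega)
      linarith
    have := hchk A (Finset.mem_Icc.2 ⟨hA, hA11⟩) B (Finset.mem_Icc.2 ⟨by linarith, by linarith⟩) hB
      ⟨C, by linarith⟩ (by rw [hC]; exact hAC)
    rw [hC] at this
    rcases this with h | h | h | h | h
    · exact ⟨1, 0, Or.inl (by linarith)⟩
    · exact ⟨1, 0, Or.inr (by linarith)⟩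
    · exact ⟨0, 1, Or.inr (by linarith)⟩
    · exact ⟨1, 1, Or.inr (by linarith)⟩
    · exact ⟨1, -1, Or.inr (by linarith)⟩

theorem shell_finite (hD : b ^ 2 + 4 * a < 0) (M : ℤ) :
    {α : QuadraticAlgebra ℤ a b | norm α = M}.Finite := by
  have hinj : Function.Injective (fun α : QuadraticAlgebra ℤ a b => (tr α, α.im)) := by
    intro α β h
    simp only [Prod.mk.injEq, tr] at h
    obtain ⟨h1, h2⟩ := h
    rw [h2] at h1
    exact QuadraticAlgebra.ext (by linarith) h2
  refine Set.Finite.of_finite_image (f := fun α : QuadraticAlgebra ℤ a b => (tr α, α.im)) ?_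
    hinj.injOn
  refine ((Set.finite_Icc (-(4 * M)) (4 * M)).prod (Set.finite_Icc (-(4 * M)) (4 * M))).subset ?_
  rintro _ ⟨α, hα, rfl⟩
  have h4 := four_norm_s2 α
  rw [Set.mem_ofPred_eq] at hα
  rw [hα] at h4
  have hb1 : tr α ^ 2 ≤ 4 * M := by nlinarith [sq_nonneg α.im]
  have hb2 : α.im ^ 2 ≤ 4 * M := by nlinarith [sq_nonneg α.im, sq_nonneg (tr α)]
  have aux : ∀ t : ℤ, t ^ 2 ≤ 4 * M → t ∈ Set.Icc (-(4 * M)) (4 * M) := by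
    intro t ht
    have h5 : |t| ≤ t ^ 2 := by
      rw [← sq_abs t]
      rcases (abs_nonneg t).eq_or_lt with h | h
      · rw [← h]; norm_num
      · nlinarith
    rw [Set.mem_Icc, ← abs_le]
    exact h5.trans ht
  exact ⟨aux _ hb1, aux _ hb2⟩

theorem fin (d m : ℕ) (A B C : ℤ) (hABC : npABC d = (A, B, C)) {a b q k : ℤ} (hd : Dat a b q k)
    (ε : ℤ) (c1 c2 : ℚ)
    (hform : ∀ x y : ℤ, norm (⟨q * x + k * (ε * x + y), ε * x + y⟩ : QuadraticAlgebra ℤ a b) =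
      q * (A * x ^ 2 + B * x * y + C * y ^ 2))
    (hV : ∀ x y : ℤ, (((2 * A * x + B * y) ^ 2 + (B ^ 2 - 4 * A * C) * y ^ 2 : ℤ) : ℚ) / (4 * (A : ℚ)) =
      c1 * (((⟨q * x + k * (ε * x + y), ε * x + y⟩ : QuadraticAlgebra ℤ a b) *
        (⟨q * x + k * (ε * x + y), ε * x + y⟩ : QuadraticAlgebra ℤ a b)).re : ℤ) +
      c2 * (((⟨q * x + k * (ε * x + y), ε * x + y⟩ : QuadraticAlgebra ℤ a b) *
        (⟨q * x + k * (ε * x + y), ε * x + y⟩ : QuadraticAlgebra ℤ a b)).im : ℤ))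
    (hc : 0 < q ∧ c1 ≠ 0) (hne : (shellNp d m).Nonempty) (hm : 0 < m) :
    (∑ᶠ p ∈ shellNp d m, Vnp d p) ≠ 0 := by
  obtain ⟨hq0, hc1⟩ := hc
  have hD0 : b ^ 2 + 4 * a < 0 := by have := hd.neg; linarith
  obtain ⟨M, hM⟩ : ∃ M : ℕ, (M : ℤ) = q * m := ⟨(q * m).toNat, by
    apply Int.toNat_of_nonneg; positivity⟩
  have hM0 : 0 < M := by
    have : (0 : ℤ) < M := by rw [hM]; positivity
    exact_mod_cast this
  set X := (shell_finite (a := a) (b := b) hD0 M).toFinset with hXdef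
  have hX : ∀ α, α ∈ X ↔ norm α = M := by intro α; simp [hXdef]
  let φ : ℤ × ℤ → QuadraticAlgebra ℤ a b := fun p => ⟨q * p.1 + k * (ε * p.1 + p.2), ε * p.1 + p.2⟩
  have hshell : ∀ p : ℤ × ℤ, p ∈ shellNp d m ↔ A * p.1 ^ 2 + B * p.1 * p.2 + C * p.2 ^ 2 = m := by
    intro p
    simp [shellNp, fnp, hABC]
  have hbij : Set.BijOn φ (shellNp d m) (X : Set (QuadraticAlgebra ℤ a b)) := by
    refine ⟨?_, ?_, ?_⟩
    · intro p hp
      rw [hshell] at hp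
      rw [Finset.mem_coe, hX, hform p.1 p.2, hp, hM]
    · intro p _ r _ hpr
      have e1 := congrArg QuadraticAlgebra.re hpr
      have e2 := congrArg QuadraticAlgebra.im hpr
      simp only [φ] at e1 e2
      have e3 : p.1 = r.1 := by
        apply mul_left_cancel₀ hq0.ne'
        rw [e2] at e1; linarith
      rw [e3] at e2
      exact Prod.ext e3 (by linarith)
    · intro α hα
      rw [Finset.mem_coe, hX] at hα
      obtain ⟨x, hx⟩ := hd.dvd_sub (z := α) (by rw [hα, hM]; exact dvd_mul_right _ _)
      have hφ : φ (x, α.im - ε * x) = α := by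
        ext
        · simp only [φ]; linear_combination -hx
        · simp only [φ]; ring
      refine ⟨(x, α.im - ε * x), ?_, hφ⟩
      rw [hshell]
      apply mul_left_cancel₀ hq0.ne'
      have h6 : norm (φ (x, α.im - ε * x)) = M := by rw [hφ, hα]
      rw [← hM, ← h6]
      exact (hform _ _).symm
  have hXne : X.Nonempty := by
    obtain ⟨p, hp⟩ := hne
    exact ⟨φ p, hbij.1 hp⟩
  have hsum := shell_sum_ne hd.neg M hM0 hd.good X hX hXne
  have key : (∑ᶠ p ∈ shellNp d m, Vnp d p) =
      ∑ᶠ α ∈ (X : Set (QuadraticAlgebra ℤ a b)), (c1 * ((α ^ 2).re : ℤ) + c2 * ((α ^ 2).im : ℤ)) := by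
    apply finsum_mem_eq_of_bijOn φ hbij
    intro p _
    rw [pow_two, ← hV p.1 p.2]
    simp [Vnp, hABC]
  rw [key, finsum_mem_coe_finset, Finset.sum_add_distrib, ← Finset.mul_sum, ← Finset.mul_sum]
  have hre : (∑ α ∈ X, (((α ^ 2).re : ℤ) : ℚ)) = (((∑ α ∈ X, α ^ 2).re : ℤ) : ℚ) := by
    rw [← Int.cast_sum]
    congr 1
    exact (map_sum (QuadraticAlgebra.reₗ a b) (fun α => α ^ 2) X).symm
  have him : (∑ α ∈ X, (((α ^ 2).im : ℤ) : ℚ)) = (((∑ α ∈ X, α ^ 2).im : ℤ) : ℚ) := by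
    rw [← Int.cast_sum]
    congr 1
    exact (map_sum (QuadraticAlgebra.imₗ a b) (fun α => α ^ 2) X).symm
  rw [hre, him]
  have hstar : star (∑ α ∈ X, α ^ 2) = ∑ α ∈ X, α ^ 2 := by
    rw [star_sum]
    refine Finset.sum_nbij' (fun α => star α) (fun α => star α) ?_ ?_ ?_ ?_ ?_
    · intro α hα
      rw [hX] at hα ⊢
      rw [QuadraticAlgebra.norm_star, hα]
    · intro α hα
      rw [hX] at hα ⊢
      rw [QuadraticAlgebra.norm_star, hα]
    · intro α _; simp
    · intro α _; simp
    · intro α _; simp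
  have him0 : (∑ α ∈ X, α ^ 2).im = 0 := by
    have := congrArg QuadraticAlgebra.im hstar
    rw [im_star] at this
    linarith
  rw [him0]
  have hre0 : (∑ α ∈ X, α ^ 2).re ≠ 0 := fun h => hsum (QuadraticAlgebra.ext h him0)
  have : (((∑ α ∈ X, α ^ 2).re : ℤ) : ℚ) ≠ 0 := by exact_mod_cast hre0
  simpa using ⟨hc1, hre0⟩

end QShell

open QShell QuadraticAlgebra in
/-- For `d` in the list of squarefree values with `ℚ(√−d)` of class number 2 and any positive
integer `m`, if the shell `S^a_d(m)` of the nonprincipal form is nonempty then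
`∑_{(x,y) ∈ S^a_d(m)} V^a_d(x,y) ≠ 0`; in particular the shell of norm `m` of the lattice
`L_a` attached to the nonprincipal ideal class of `ℚ(√−d)` is not a spherical 2-design. -/
theorem stmt_2 (d : ℕ)
    (hd : d ∈ ({5, 6, 10, 13, 15, 22, 35, 37, 51, 58, 91, 115, 123, 187, 235, 267, 403, 427} :
      Finset ℕ))
    (m : ℕ) (hm : 0 < m) (hne : (shellNp d m).Nonempty) :
    (∑ᶠ p ∈ shellNp d m, Vnp d p) ≠ 0 := by
  simp only [Finset.mem_insert, Finset.mem_singleton] at hd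
  rcases hd with rfl | rfl | rfl | rfl | rfl | rfl | rfl | rfl | rfl | rfl | rfl | rfl | rfl | rfl | rfl | rfl | rfl | rfl
  · exact fin 5 m 2 2 3 rfl (a := -5) (b := 0) (q := 2) (k := 1) (mk_dat (by norm_num) (by norm_num) (by norm_num) (by norm_num) (by decide +kernel) (by norm_num) (by norm_num) (by norm_num) (by decide +kernel)) 0 (1/2) (0) (by intro x y; simp only [norm_def]; ring) (by intro x y; simp only [re_mul, im_mul]; push_cast; ring) (by norm_num) hne hm
  · exact fin 6 m 2 0 3 rfl (a := -6) (b := 0) (q := 2) (k := 0) (mk_dat (by norm_num) (by norm_num) (by norm_num) (by norm_num) (by decide +kernel) (by norm_num) (by norm_num) (by norm_num) (by decide +kernel)) 0 (1/2) (0) (by intro x y; simp only [norm_def]; ring) (by intro x y; simp only [re_mul, im_mul]; push_cast; ring) (by norm_num) hne hm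
  · exact fin 10 m 2 0 5 rfl (a := -10) (b := 0) (q := 2) (k := 0) (mk_dat (by norm_num) (by norm_num) (by norm_num) (by norm_num) (by decide +kernel) (by norm_num) (by norm_num) (by norm_num) (by decide +kernel)) 0 (1/2) (0) (by intro x y; simp only [norm_def]; ring) (by intro x y; simp only [re_mul, im_mul]; push_cast; ring) (by norm_num) hne hm
  · exact fin 13 m 2 2 7 rfl (a := -13) (b := 0) (q := 2) (k := 1) (mk_dat (by norm_num) (by norm_num) (by norm_num) (by norm_num) (by decide +kernel) (by norm_num) (by norm_num) (by norm_num) (by decide +kernel)) 0 (1/2) (0) (by intro x y; simp only [norm_def]; ring) (by intro x y; simp only [re_mul, im_mul]; push_cast; ring) (by norm_num) hne hm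
  · exact fin 15 m 2 1 2 rfl (a := -4) (b := 1) (q := 3) (k := -2) (mk_dat (by norm_num) (by norm_num) (by norm_num) (by norm_num) (by decide +kernel) (by norm_num) (by norm_num) (by norm_num) (by decide +kernel)) 1 (-1/12) (7/12) (by intro x y; simp only [norm_def]; ring) (by intro x y; simp only [re_mul, im_mul]; push_cast; ring) (by norm_num) hne hm
  · exact fin 22 m 2 0 11 rfl (a := -22) (b := 0) (q := 2) (k := 0) (mk_dat (by norm_num) (by norm_num) (by norm_num) (by norm_num) (by decide +kernel) (by norm_num) (by norm_num) (by norm_num) (by decide +kernel)) 0 (1/2) (0) (by intro x y; simp only [norm_def]; ring) (by intro x y; simp only [re_mul, im_mul]; push_cast; ring) (by norm_num) hne hm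
  · exact fin 35 m 3 1 3 rfl (a := -9) (b := 1) (q := 5) (k := -3) (mk_dat (by norm_num) (by norm_num) (by norm_num) (by norm_num) (by decide +kernel) (by norm_num) (by norm_num) (by norm_num) (by decide +kernel)) 1 (-1/30) (17/30) (by intro x y; simp only [norm_def]; ring) (by intro x y; simp only [re_mul, im_mul]; push_cast; ring) (by norm_num) hne hm
  · exact fin 37 m 2 2 19 rfl (a := -37) (b := 0) (q := 2) (k := 1) (mk_dat (by norm_num) (by norm_num) (by norm_num) (by norm_num) (by decide +kernel) (by norm_num) (by norm_num) (by norm_num) (by decide +kernel)) 0 (1/2) (0) (by intro x y; simp only [norm_def]; ring) (by intro x y; simp only [re_mul, im_mul]; push_cast; ring) (by norm_num) hne hm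
  · exact fin 51 m 3 3 5 rfl (a := -13) (b := 1) (q := 3) (k := 1) (mk_dat (by norm_num) (by norm_num) (by norm_num) (by norm_num) (by decide +kernel) (by norm_num) (by norm_num) (by norm_num) (by decide +kernel)) 0 (1/3) (1/6) (by intro x y; simp only [norm_def]; ring) (by intro x y; simp only [re_mul, im_mul]; push_cast; ring) (by norm_num) hne hm
  · exact fin 58 m 2 0 29 rfl (a := -58) (b := 0) (q := 2) (k := 0) (mk_dat (by norm_num) (by norm_num) (by norm_num) (by norm_num) (by decide +kernel) (by norm_num) (by norm_num) (by norm_num) (by decide +kernel)) 0 (1/2) (0) (by intro x y; simp only [norm_def]; ring) (by intro x y; simp only [re_mul, im_mul]; push_cast; ring) (by norm_num) hne hm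
  · exact fin 91 m 5 3 5 rfl (a := -23) (b := 1) (q := 7) (k := -4) (mk_dat (by norm_num) (by norm_num) (by norm_num) (by norm_num) (by decide +kernel) (by norm_num) (by norm_num) (by norm_num) (by decide +kernel)) 1 (-3/70) (22/35) (by intro x y; simp only [norm_def]; ring) (by intro x y; simp only [re_mul, im_mul]; push_cast; ring) (by norm_num) hne hm
  · exact fin 115 m 5 5 7 rfl (a := -29) (b := 1) (q := 5) (k := 2) (mk_dat (by norm_num) (by norm_num) (by norm_num) (by norm_num) (by decide +kernel) (by norm_num) (by norm_num) (by norm_num) (by decide +kernel)) 0 (1/5) (1/10) (by intro x y; simp only [norm_def]; ring) (by intro x y; simp only [re_mul, im_mul]; push_cast; ring) (by norm_num) hne hm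
  · exact fin 123 m 3 3 11 rfl (a := -31) (b := 1) (q := 3) (k := 1) (mk_dat (by norm_num) (by norm_num) (by norm_num) (by norm_num) (by decide +kernel) (by norm_num) (by norm_num) (by norm_num) (by decide +kernel)) 0 (1/3) (1/6) (by intro x y; simp only [norm_def]; ring) (by intro x y; simp only [re_mul, im_mul]; push_cast; ring) (by norm_num) hne hm
  · exact fin 187 m 7 3 7 rfl (a := -47) (b := 1) (q := 11) (k := -6) (mk_dat (by norm_num) (by norm_num) (by norm_num) (by norm_num) (by decide +kernel) (by norm_num) (by norm_num) (by norm_num) (by decide +kernel)) 1 (-3/154) (46/77) (by intro x y; simp only [norm_def]; ring) (by intro x y; simp only [re_mul, im_mul]; push_cast; ring) (by norm_num) hne hm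
  · exact fin 235 m 5 5 13 rfl (a := -59) (b := 1) (q := 5) (k := 2) (mk_dat (by norm_num) (by norm_num) (by norm_num) (by norm_num) (by decide +kernel) (by norm_num) (by norm_num) (by norm_num) (by decide +kernel)) 0 (1/5) (1/10) (by intro x y; simp only [norm_def]; ring) (by intro x y; simp only [re_mul, im_mul]; push_cast; ring) (by norm_num) hne hm
  · exact fin 267 m 3 3 23 rfl (a := -67) (b := 1) (q := 3) (k := 1) (mk_dat (by norm_num) (by norm_num) (by norm_num) (by norm_num) (by decide +kernel) (by norm_num) (by norm_num) (by norm_num) (by decide +kernel)) 0 (1/3) (1/6) (by intro x y; simp only [norm_def]; ring) (by intro x y; simp only [re_mul, im_mul]; push_cast; ring) (by norm_num) hne hm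
  · exact fin 403 m 11 9 11 rfl (a := -101) (b := 1) (q := 13) (k := -7) (mk_dat (by norm_num) (by norm_num) (by norm_num) (by norm_num) (by decide +kernel) (by norm_num) (by norm_num) (by norm_num) (by decide +kernel)) 1 (-9/286) (197/286) (by intro x y; simp only [norm_def]; ring) (by intro x y; simp only [re_mul, im_mul]; push_cast; ring) (by norm_num) hne hm
  · exact fin 427 m 7 7 17 rfl (a := -107) (b := 1) (q := 7) (k := 3) (mk_dat (by norm_num) (by norm_num) (by norm_num) (by norm_num) (by decide +kernel) (by norm_num) (by norm_num) (by norm_num) (by decide +kernel)) 0 (1/7) (1/14) (by intro x y; simp only [norm_def]; ring) (by intro x y; simp only [re_mul, im_mul]; push_cast; ring) (by norm_num) hne hm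
end

section
/- Let d be a squarefree positive integer such that K = ℚ(√−d) has class number 2, let I be a nonzero nonprincipal integral ideal of 𝓞_K of absolute norm n, and let m be the absolute norm of some nonzero nonprincipal integral ideal of 𝓞_K. If d ≡ 1 or 2 (mod 4), then there exist integers a, b with m·n = a² + d·b². If d ≡ 3 (mod 4), then there exist integers a, b such that m·n = a² + d·b² or 4·m·n = a² + d·b². -/
open NumberField

theorem aux_norm (d : ℕ) (hsf : Squarefree d) (hd0 : 0 < d)
    (K : Type) [Field K] [NumberField K]
    (hdeg : Module.finrank ℚ K = 2) (α : K) (hα : α ^ 2 = -(d : K)) (x : 𝓞 K) :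
    ∃ t u : ℤ, 4 * Algebra.norm ℤ x = t ^ 2 + (d : ℤ) * u ^ 2 := by
  have hdq : (0 : ℚ) < d := by exact_mod_cast hd0
  have hli : LinearIndependent ℚ ![(1 : K), α] := by
    rw [LinearIndependent.pair_iff]
    intro s t h
    have h1 : (algebraMap ℚ K) (s ^ 2 + d * t ^ 2) = 0 := by
      simp only [Algebra.smul_def, mul_one] at h
      have hs : algebraMap ℚ K s = - (algebraMap ℚ K t * α) := eq_neg_of_add_eq_zero_left h
      simp only [map_add, map_mul, map_pow, map_natCast, hs]
      linear_combination (algebraMap ℚ K t) ^ 2 * hα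
    have h2 : s ^ 2 + d * t ^ 2 = 0 := by
      exact (map_eq_zero (algebraMap ℚ K)).mp h1
    have h3 : 0 ≤ (d : ℚ) * t ^ 2 := by positivity
    have h4 : s ^ 2 = 0 := by nlinarith [sq_nonneg s]
    have h5 : (d : ℚ) * t ^ 2 = 0 := by linarith
    constructor
    · simpa using h4
    · simpa [hdq.ne'] using h5
  let b : Module.Basis (Fin 2) ℚ K :=
    basisOfLinearIndependentOfCardEqFinrank hli (by simp [hdeg])
  have hb : ⇑b = ![(1 : K), α] := coe_basisOfLinearIndependentOfCardEqFinrank _ _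
  have hb0 : b 0 = 1 := by simp [hb]
  have hb1 : b 1 = α := by simp [hb]
  set r := b.repr (x : K) 0 with hr
  set s := b.repr (x : K) 1 with hs
  have hx : (x : K) = r • b 0 + s • b 1 := by
    have := b.sum_repr (x : K)
    rw [Fin.sum_univ_two] at this
    exact this.symm
  have hx1 : (x : K) * b 1 = (-(d : ℚ) * s) • b 0 + r • b 1 := by
    rw [hx, hb0, hb1]
    simp only [Algebra.smul_def, map_mul, map_neg, map_natCast]
    linear_combination (algebraMap ℚ K s) * hα
  have hx0 : (x : K) * b 0 = r • b 0 + s • b 1 := by rw [← hx, hb0, mul_one]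
  have hN : Algebra.norm ℚ (x : K) = r ^ 2 + d * s ^ 2 := by
    rw [Algebra.norm_eq_matrix_det b, Matrix.det_fin_two]
    simp only [Algebra.leftMulMatrix_eq_repr_mul, hx0, hx1]
    simp
    ring
  have hT : Algebra.trace ℚ K (x : K) = 2 * r := by
    rw [Algebra.trace_eq_matrix_trace b, Matrix.trace_fin_two]
    simp only [Algebra.leftMulMatrix_eq_repr_mul, hx0, hx1]
    simp
    ring
  have hN' : ((Algebra.norm ℤ x : ℤ) : ℚ) = r ^ 2 + d * s ^ 2 := by
    rw [← hN]; exact Algebra.coe_norm_int x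
  have hT' : ((Algebra.trace ℤ (𝓞 K) x : ℤ) : ℚ) = 2 * r := by
    rw [← hT]; exact Algebra.coe_trace_int x
  set N := Algebra.norm ℤ x
  set t := Algebra.trace ℤ (𝓞 K) x
  have key : (d : ℚ) * (2 * s) ^ 2 = ((4 * N - t ^ 2 : ℤ) : ℚ) := by
    push_cast
    rw [hN', hT']; ring
  -- the rational number v = 2 s is an integer
  obtain ⟨v, hv⟩ : ∃ v : ℚ, v = 2 * s := ⟨_, rfl⟩
  rw [← hv] at key
  have hden : v.den = 1 := by
    have h1 : (d : ℤ) * v.num ^ 2 = (4 * N - t ^ 2) * (v.den : ℤ) ^ 2 := by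
      have hne : (v.den : ℚ) ≠ 0 := by exact_mod_cast v.den_nz
      have hvv : v * v.den = v.num := Rat.mul_den_eq_num v
      have : (d : ℚ) * v.num ^ 2 = ((4 * N - t ^ 2 : ℤ) : ℚ) * (v.den : ℚ) ^ 2 := by
        rw [← hvv, ← key]; ring
      exact_mod_cast this
    have h2 : ((v.den : ℤ)) ^ 2 ∣ (d : ℤ) * v.num ^ 2 := ⟨4 * N - t ^ 2, by rw [h1]; ring⟩
    have hc : IsCoprime ((v.den : ℤ) ^ 2) (v.num ^ 2) := by
      apply IsCoprime.pow
      rw [Int.isCoprime_iff_nat_coprime]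
      simpa using v.reduced.symm
    have h3 : ((v.den : ℤ)) ^ 2 ∣ (d : ℤ) := hc.dvd_of_dvd_mul_right h2
    have h4 : v.den * v.den ∣ d := by
      rw [← sq]; exact_mod_cast h3
    exact Nat.isUnit_iff.mp (hsf _ h4)
  have hvn : (v.num : ℚ) = v := by
    have := Rat.mul_den_eq_num v
    rw [hden] at this; simpa using this.symm
  refine ⟨t, v.num, ?_⟩
  have : (d : ℚ) * (v.num : ℚ) ^ 2 = ((4 * N - t ^ 2 : ℤ) : ℚ) := by rw [hvn, key]
  have h : (d : ℤ) * v.num ^ 2 = 4 * N - t ^ 2 := by exact_mod_cast this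
  linarith

theorem aux_mod (d : ℕ) (h : d % 4 = 1 ∨ d % 4 = 2) (N t u : ℤ)
    (e : 4 * N = t ^ 2 + (d : ℤ) * u ^ 2) : ∃ a b : ℤ, N = a ^ 2 + (d : ℤ) * b ^ 2 := by
  obtain ⟨k, hk⟩ : ∃ k : ℤ, (d : ℤ) = 4 * k + 1 ∨ (d : ℤ) = 4 * k + 2 :=
    ⟨(d : ℤ) / 4, by omega⟩
  have ht : t % 2 = 0 ∧ u % 2 = 0 := by
    obtain ⟨a, ha⟩ : ∃ a, t = 2 * a ∨ t = 2 * a + 1 := ⟨t / 2, by omega⟩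
    obtain ⟨b, hb⟩ : ∃ b, u = 2 * b ∨ u = 2 * b + 1 := ⟨u / 2, by omega⟩
    rcases hk with hk | hk <;> rcases ha with rfl | rfl <;> rcases hb with rfl | rfl <;>
      rw [hk] at e <;> ring_nf at e <;> omega
  obtain ⟨a, rfl⟩ : ∃ a, t = 2 * a := ⟨t / 2, by omega⟩
  obtain ⟨b, rfl⟩ : ∃ b, u = 2 * b := ⟨u / 2, by omega⟩
  exact ⟨a, b, by linarith⟩

theorem aux_prin (K : Type) [Field K] [NumberField K]
    (hcl : NumberField.classNumber K = 2) (I J : Ideal (𝓞 K)) (hI : I ≠ ⊥) (hJ : J ≠ ⊥)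
    (hIp : ¬ I.IsPrincipal) (hJp : ¬ J.IsPrincipal) : (J * I).IsPrincipal := by
  have hI0 : I ∈ nonZeroDivisors (Ideal (𝓞 K)) := mem_nonZeroDivisors_of_ne_zero hI
  have hJ0 : J ∈ nonZeroDivisors (Ideal (𝓞 K)) := mem_nonZeroDivisors_of_ne_zero hJ
  have hc : Nat.card (ClassGroup (𝓞 K)) = 2 := by
    rw [← hcl, NumberField.classNumber, Nat.card_eq_fintype_card]
  have h1 : ClassGroup.mk0 ⟨I, hI0⟩ ≠ 1 := fun h => hIp ((ClassGroup.mk0_eq_one_iff hI0).mp h)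
  have h2 : ClassGroup.mk0 ⟨J, hJ0⟩ ≠ 1 := fun h => hJp ((ClassGroup.mk0_eq_one_iff hJ0).mp h)
  obtain ⟨y, hy, hyu⟩ := (Nat.card_eq_two_iff' (1 : ClassGroup (𝓞 K))).mp hc
  have h3 : ClassGroup.mk0 ⟨J, hJ0⟩ = ClassGroup.mk0 ⟨I, hI0⟩ := (hyu _ h2).trans (hyu _ h1).symm
  have h4 : ClassGroup.mk0 ⟨J, hJ0⟩ * ClassGroup.mk0 ⟨I, hI0⟩ = 1 := by
    rw [h3, ← sq, ← hc]; exact pow_card_eq_one'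
  rw [← map_mul] at h4
  exact (ClassGroup.mk0_eq_one_iff (mul_mem hJ0 hI0)).mp h4

/-- Let `d` be a squarefree positive integer such that `K = ℚ(√−d)` has class number 2,
let `I` be a nonzero nonprincipal integral ideal of `𝓞_K` of absolute norm `n`, and let
`m` be the absolute norm of some nonzero nonprincipal integral ideal of `𝓞_K`. Then:
if `d ≡ 1, 2 (mod 4)` there are integers `a, b` with `m·n = a² + d·b²`, and if
`d ≡ 3 (mod 4)` there are integers `a, b` with `m·n = a² + d·b²` or `4·m·n = a² + d·b²`. -/
theorem stmt_4 (d : ℕ) (hsf : Squarefree d) (hd0 : 0 < d)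
    (K : Type) [Field K] [NumberField K]
    (hdeg : Module.finrank ℚ K = 2)
    (hsqrt : ∃ α : K, α ^ 2 = -(d : K))
    (hcl : NumberField.classNumber K = 2)
    (I : Ideal (𝓞 K)) (hI : I ≠ ⊥) (hIprin : ¬ I.IsPrincipal)
    (n : ℕ) (hn : Ideal.absNorm I = n)
    (m : ℕ) (hm : ∃ J : Ideal (𝓞 K), J ≠ ⊥ ∧ ¬ J.IsPrincipal ∧ Ideal.absNorm J = m) :
    (d % 4 = 1 ∨ d % 4 = 2 → ∃ a b : ℤ, (m : ℤ) * n = a ^ 2 + (d : ℤ) * b ^ 2) ∧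
    (d % 4 = 3 → ∃ a b : ℤ,
      (m : ℤ) * n = a ^ 2 + (d : ℤ) * b ^ 2 ∨ 4 * (m : ℤ) * n = a ^ 2 + (d : ℤ) * b ^ 2) := by
  obtain ⟨J, hJ, hJp, rfl⟩ := hm
  obtain ⟨α, hα⟩ := hsqrt
  subst hn
  obtain ⟨x, hx⟩ := aux_prin K hcl I J hI hJ hIprin hJp
  obtain ⟨t, u, e⟩ := aux_norm d hsf hd0 K hdeg α hα x
  have hnn : 0 ≤ Algebra.norm ℤ x := by
    have : (0 : ℤ) ≤ (d : ℤ) * u ^ 2 := by positivity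
    nlinarith [sq_nonneg t]
  have hN : (Ideal.absNorm J : ℤ) * Ideal.absNorm I = Algebra.norm ℤ x := by
    rw [← Nat.cast_mul, ← map_mul, hx]
    change ((Ideal.absNorm (Ideal.span {x}) : ℕ) : ℤ) = _
    rw [Ideal.absNorm_span_singleton, Int.natAbs_of_nonneg hnn]
  refine ⟨fun h => ?_, fun _ => ⟨t, u, Or.inr ?_⟩⟩
  · rw [hN]; exact aux_mod d h _ t u e
  · rw [mul_assoc, hN, e]
end

section
/- Let d be a squarefree positive integer such that K = ℚ(√−d) has class number 2. If I and J are nonzero integral ideals of 𝓞_K with the same absolute norm, then I and J determine the same element of the ideal class group of K. In particular, no positive integer is simultaneously the absolute norm of a nonzero principal integral ideal and the absolute norm of a nonprincipal integral ideal of 𝓞_K. -/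
open NumberField nonZeroDivisors

lemma aux_conj (K : Type) [Field K] [NumberField K] [IsGalois ℚ K] (P Q : Ideal (𝓞 K))
    [P.IsPrime] [Q.IsPrime] (h : P.under ℤ = Q.under ℤ) :
    ∃ e : 𝓞 K ≃+* 𝓞 K, Q = P.map (e : 𝓞 K →+* 𝓞 K) := by
  have : IsGaloisGroup Gal(K/ℚ) ℤ (𝓞 K) := IsGaloisGroup.of_isFractionRing _ _ _ ℚ K
  obtain ⟨g, hg⟩ := Algebra.IsInvariant.exists_smul_of_under_eq ℤ (𝓞 K) Gal(K/ℚ) P Q h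
  exact ⟨MulSemiringAction.toRingEquiv _ _ g, hg⟩

lemma aux_principal {R : Type} [CommRing R] (e : R ≃+* R) (P : Ideal R) (h : P.IsPrincipal) :
    (P.map (e : R →+* R)).IsPrincipal := by
  obtain ⟨a, rfl⟩ := h
  refine ⟨e a, ?_⟩
  have := Ideal.map_span (e : R →+* R) {a}
  simpa using this

lemma aux_two {G : Type} [Group G] [Fintype G] (h : Fintype.card G = 2) (a b : G)
    (hab : a = 1 ↔ b = 1) : a = b := by
  by_contra hne
  have ha : a ≠ 1 := fun h => hne (h.trans (hab.1 h).symm)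
  have hb : b ≠ 1 := fun h => ha (hab.2 h)
  have : 2 < Fintype.card G := Fintype.two_lt_card_iff.2 ⟨a, b, 1, hne, ha, hb⟩
  omega

lemma aux_main (K : Type) [Field K] [NumberField K] [IsGalois ℚ K]
    (hcl : NumberField.classNumber K = 2) (n : ℕ) :
    ∀ I J : (Ideal (𝓞 K))⁰, Ideal.absNorm (I : Ideal (𝓞 K)) = n →
      Ideal.absNorm (J : Ideal (𝓞 K)) = n → ClassGroup.mk0 I = ClassGroup.mk0 J := by
  induction n using Nat.strong_induction_on with
  | _ n ih =>
  intro I J hI hJ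
  have hn0 : n ≠ 0 := by
    rw [← hI]
    exact Ideal.absNorm_ne_zero_iff_mem_nonZeroDivisors.2 I.2
  by_cases hn : n = 1
  · subst hn
    rw [Ideal.absNorm_eq_one_iff] at hI hJ
    rw [Subtype.ext (hI.trans hJ.symm)]
  obtain ⟨p, hp, hpn⟩ := Nat.exists_prime_and_dvd hn
  obtain ⟨P, hPm, hPu, I', hPI⟩ := Ideal.exists_isMaximal_dvd_of_dvd_absNorm' hp (I : Ideal (𝓞 K))
    (hI ▸ hpn)
  obtain ⟨Q, hQm, hQu, J', hQJ⟩ := Ideal.exists_isMaximal_dvd_of_dvd_absNorm' hp (J : Ideal (𝓞 K))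
    (hJ ▸ hpn)
  obtain ⟨e, he⟩ := aux_conj K P Q (hPu.trans hQu.symm)
  have hNPQ : P.absNorm = Q.absNorm :=
    Nat.card_congr (Ideal.quotientEquiv P Q e he).toEquiv
  have hI0 := nonZeroDivisors.coe_ne_zero I
  have hJ0 := nonZeroDivisors.coe_ne_zero J
  rw [hPI] at hI hI0
  rw [hQJ] at hJ hJ0
  have hP0 := mem_nonZeroDivisors_of_ne_zero (left_ne_zero_of_mul hI0)
  have hI'0 := mem_nonZeroDivisors_of_ne_zero (right_ne_zero_of_mul hI0)
  have hQ0 := mem_nonZeroDivisors_of_ne_zero (left_ne_zero_of_mul hJ0)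
  have hJ'0 := mem_nonZeroDivisors_of_ne_zero (right_ne_zero_of_mul hJ0)
  have hIe : I = ⟨P, hP0⟩ * ⟨I', hI'0⟩ := Subtype.ext hPI
  have hJe : J = ⟨Q, hQ0⟩ * ⟨J', hJ'0⟩ := Subtype.ext hQJ
  rw [hIe, hJe, map_mul, map_mul]
  rw [map_mul] at hI hJ
  have hPpos : P.absNorm ≠ 0 := Ideal.absNorm_ne_zero_iff_mem_nonZeroDivisors.2 hP0
  have hP1 : P.absNorm ≠ 1 := fun h => hPm.ne_top (Ideal.absNorm_eq_one_iff.1 h)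
  have hI'pos : I'.absNorm ≠ 0 := Ideal.absNorm_ne_zero_iff_mem_nonZeroDivisors.2 hI'0
  have hcls : ClassGroup.mk0 ⟨P, hP0⟩ = ClassGroup.mk0 ⟨Q, hQ0⟩ := by
    apply aux_two hcl
    rw [ClassGroup.mk0_eq_one_iff, ClassGroup.mk0_eq_one_iff]
    constructor
    · intro h
      rw [he]
      exact aux_principal e P h
    · intro h
      have : P = Q.map (e.symm : 𝓞 K →+* 𝓞 K) := by
        rw [he, Ideal.map_map]
        simp
      rw [this]
      exact aux_principal e.symm Q h
  rw [hcls, ih I'.absNorm ?_ ⟨I', hI'0⟩ ⟨J', hJ'0⟩ rfl ?_]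
  · rw [← hI]
    have : 1 < P.absNorm := by omega
    exact lt_mul_of_one_lt_left (by omega) this
  · rw [← hNPQ] at hJ
    exact Nat.eq_of_mul_eq_mul_left (by omega) (hJ.trans hI.symm)


/-- Let `d` be a squarefree positive integer such that `K = ℚ(√−d)` has class number 2.
If `I` and `J` are nonzero integral ideals of `𝓞_K` with the same absolute norm, then `I`
and `J` determine the same element of the ideal class group of `K`. In particular, no
positive integer is simultaneously the absolute norm of a nonzero principal integral ideal
and the absolute norm of a nonprincipal integral ideal of `𝓞_K`. -/
theorem stmt_6 (d : ℕ) (hsf : Squarefree d) (hd0 : 0 < d)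
    (K : Type) [Field K] [NumberField K]
    (hdeg : Module.finrank ℚ K = 2)
    (hsqrt : ∃ α : K, α ^ 2 = -(d : K))
    (hcl : NumberField.classNumber K = 2) :
    (∀ I J : (Ideal (𝓞 K))⁰,
      Ideal.absNorm (I : Ideal (𝓞 K)) = Ideal.absNorm (J : Ideal (𝓞 K)) →
        ClassGroup.mk0 I = ClassGroup.mk0 J) ∧
    (∀ I J : Ideal (𝓞 K), I ≠ ⊥ → J ≠ ⊥ → I.IsPrincipal → ¬ J.IsPrincipal →
      Ideal.absNorm I ≠ Ideal.absNorm J) := by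
  have : Algebra.IsQuadraticExtension ℚ K := ⟨hdeg⟩
  have h1 : ∀ I J : (Ideal (𝓞 K))⁰,
      Ideal.absNorm (I : Ideal (𝓞 K)) = Ideal.absNorm (J : Ideal (𝓞 K)) →
        ClassGroup.mk0 I = ClassGroup.mk0 J :=
    fun I J h => aux_main K hcl _ I J h rfl
  refine ⟨h1, fun I J hI hJ hIp hJp hN => hJp ?_⟩
  have hI' := mem_nonZeroDivisors_of_ne_zero hI
  have hJ' := mem_nonZeroDivisors_of_ne_zero hJ
  rw [← ClassGroup.mk0_eq_one_iff hJ', ← h1 ⟨I, hI'⟩ ⟨J, hJ'⟩ hN,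
    ClassGroup.mk0_eq_one_iff hI']
  exact hIp
end
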